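/- arXiv:2208.00303 — 7 statements merged into one kernel-verified Lean document; each statement's English description precedes it below -/
import Mathlib

section
/- For all integers i, j with 2 ≤ i ≤ j ≤ p, the following identity of n×n matrices over ℤ[q] holds: C_{ij} − q·C_{i−1,j} = q^{j−i}·(1 − q²)·( Σ_{k=0}^{j−i} (J^t)^k + Σ_{m=1}^{i−1} q^{2m} J^m ). -/
open Matrix

noncomputable section

/-- The indeterminate `q` of `ℤ[q]`. -/
def q : Polynomial ℤ := Polynomial.X

/-- The `n × n` cyclic shift permutation matrix `J = C(0,1,0,…,0)` over `ℤ[q]`: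
the `(r,c)` entry is `1` iff `c ≡ r + 1 (mod n)`.  It satisfies `J^n = I` and
`Jᵀ = J^(n-1)`. -/
def Jmat (n : ℕ) : Matrix (Fin n) (Fin n) (Polynomial ℤ) :=
  Matrix.of fun r c => if (c : ℕ) = ((r : ℕ) + 1) % n then 1 else 0

/-- The `n × n` exchange matrix `K`: in `1`-based indexing the `(r,c)` entry is `1`
iff `r + c = n + 1`. -/
def Kmat (n : ℕ) : Matrix (Fin n) (Fin n) (Polynomial ℤ) :=
  Matrix.of fun r c => if (r : ℕ) + (c : ℕ) + 1 = n then 1 else 0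

/-- The `0`-indexed `m`-th entry of the first row of the circulant matrix `C_{ij}`:
the first row consists, in order, of the `i` entries `q^(j-i), q^(j-i+2), …, q^(j+i-2)`,
then `n+1-i-j` entries `q^(i+j)`, then the `i-1` entries `q^(j+i-2), …, q^(j-i+2)`,
then `j-i` entries `q^(j-i)`. -/
def firstRow (n i j m : ℕ) : Polynomial ℤ :=
  if m < i then q ^ (j - i + 2 * m)
  else if m + j < n + 1 then q ^ (i + j)
  else if m + j < n + i then q ^ (i + j - 2 * (m + j - n))
  else q ^ (j - i)

/-- The circulant matrix `C_{ij}` (for `1 ≤ i ≤ j ≤ p`): its `(r,c)` entry is the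
`((c - r) mod n)`-th (`0`-indexed) entry of its first row. -/
def Cmat (n i j : ℕ) : Matrix (Fin n) (Fin n) (Polynomial ℤ) :=
  Matrix.of fun r c => firstRow n i j ((c - r : Fin n) : ℕ)

theorem Jmat_pow_apply (n : ℕ) (k : ℕ) (r c : Fin n) :
    ((Jmat n) ^ k) r c = if (c : ℕ) = ((r : ℕ) + k) % n then 1 else 0 := by
  induction k generalizing c with
  | zero =>
    have hr := r.isLt
    rw [pow_zero, Matrix.one_apply, add_zero, Nat.mod_eq_of_lt hr]
    simp only [Fin.ext_iff, eq_comm]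
  | succ k ih =>
    have hn : 0 < n := r.pos
    rw [pow_succ, Matrix.mul_apply,
      Finset.sum_eq_single (⟨((r : ℕ) + k) % n, Nat.mod_lt _ hn⟩ : Fin n)]
    · rw [ih]
      simp [Jmat, add_assoc]
    · intro b _ hb
      rw [ih, if_neg, zero_mul]
      intro h
      exact hb (Fin.ext h)
    · simp

theorem sub_val_cases {n : ℕ} (r c : Fin n) :
    (r : ℕ) + ((c - r : Fin n) : ℕ) = c ∨ (r : ℕ) + ((c - r : Fin n) : ℕ) = c + n := by
  have hr := r.isLt
  have hc := c.isLt
  rw [Fin.sub_def]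
  simp only
  rcases le_or_gt (r : ℕ) c with h | h
  · left
    have : n - (r : ℕ) + c = (c - r) + n := by omega
    rw [this, Nat.add_mod_right, Nat.mod_eq_of_lt (by omega)]
    omega
  · right
    rw [Nat.mod_eq_of_lt (by omega)]
    omega

theorem add_mod_cases {n a k : ℕ} (ha : a < n) (hk : k < n) :
    (a + k < n ∧ (a + k) % n = a + k) ∨ (n ≤ a + k ∧ (a + k) % n + n = a + k) := by
  rcases lt_or_ge (a + k) n with h | h
  · exact Or.inl ⟨h, Nat.mod_eq_of_lt h⟩
  · right
    refine ⟨h, ?_⟩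
    rw [Nat.mod_eq_sub_mod h, Nat.mod_eq_of_lt (by omega)]
    omega

theorem sumT (n : ℕ) (d : ℕ) (hd : d < n) (r c : Fin n) :
    (∑ k ∈ Finset.range (d + 1), ((Jmat n)ᵀ) ^ k) r c =
      if ((c - r : Fin n) : ℕ) = 0 ∨ n ≤ ((c - r : Fin n) : ℕ) + d then 1 else 0 := by
  have hr := r.isLt
  have hc := c.isLt
  have hm := (c - r : Fin n).isLt
  have hs := sub_val_cases r c
  generalize ((c - r : Fin n) : ℕ) = m at *
  have key : ∀ k ∈ Finset.range (d + 1), (((Jmat n)ᵀ) ^ k) r c =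
      if (if m = 0 then 0 else n - m) = k then 1 else 0 := by
    intro k hk
    rw [Finset.mem_range] at hk
    rw [← Matrix.transpose_pow, Matrix.transpose_apply, Jmat_pow_apply]
    have := add_mod_cases hc (show k < n by omega)
    congr 1
    apply propext
    split_ifs <;> omega
  rw [Matrix.sum_apply, Finset.sum_congr rfl key, Finset.sum_ite_eq]
  congr 1
  apply propext
  rw [Finset.mem_range]
  split_ifs <;> omega

theorem sumJ (n : ℕ) (d : ℕ) (hd : d < n) (r c : Fin n) :
    (∑ k ∈ Finset.Icc 1 d, q ^ (2 * k) • (Jmat n) ^ k) r c =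
      if 1 ≤ ((c - r : Fin n) : ℕ) ∧ ((c - r : Fin n) : ℕ) ≤ d
        then q ^ (2 * ((c - r : Fin n) : ℕ)) else 0 := by
  have hr := r.isLt
  have hc := c.isLt
  have hm := (c - r : Fin n).isLt
  have hs := sub_val_cases r c
  generalize ((c - r : Fin n) : ℕ) = m at *
  have key : ∀ k ∈ Finset.Icc 1 d, (q ^ (2 * k) • (Jmat n) ^ k) r c =
      if m = k then q ^ (2 * k) else 0 := by
    intro k hk
    rw [Finset.mem_Icc] at hk
    rw [Matrix.smul_apply, Jmat_pow_apply, smul_eq_mul, mul_ite, mul_one, mul_zero]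
    have := add_mod_cases hr (show k < n by omega)
    congr 1
    apply propext
    omega
  rw [Matrix.sum_apply, Finset.sum_congr rfl key, Finset.sum_ite_eq]
  simp only [Finset.mem_Icc]

theorem firstRow_reduction (n i d m : ℕ) (hm : m < n) (hi : 1 ≤ i)
    (hj : 2 * (i + 1 + d) ≤ n + 1) :
    firstRow n (i + 1) (i + 1 + d) m - q * firstRow n i (i + 1 + d) m =
      (q ^ d * (1 - q ^ 2)) * ((if m = 0 ∨ n ≤ m + d then 1 else 0) +
        if 1 ≤ m ∧ m ≤ i then q ^ (2 * m) else 0) := by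
  have e1 : i + 1 + d - (i + 1) = d := by omega
  have e2 : i + 1 + d - i = d + 1 := by omega
  unfold firstRow
  rw [e1, e2]
  rcases Nat.eq_zero_or_pos m with h0 | h0
  · subst h0
    rw [if_pos (by omega), if_pos (by omega), if_pos (by omega), if_neg (by omega)]
    ring
  rcases lt_trichotomy m i with h | h | h
  · rw [if_pos (by omega), if_pos (by omega), if_neg (by omega), if_pos (by omega)]
    ring
  · rw [if_pos (by omega), if_neg (by omega), if_pos (by omega), if_neg (by omega),
      if_pos (by omega), h]
    ring
  rw [if_neg (by omega), if_neg (show ¬ m < i by omega), if_neg (show ¬ (1 ≤ m ∧ m ≤ i) by omega)]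
  rcases lt_or_ge (m + (i + 1 + d)) (n + 1) with h1 | h1
  · rw [if_pos h1, if_pos h1, if_neg (by omega)]
    ring
  rw [if_neg (show ¬ m + (i + 1 + d) < n + 1 by omega), if_neg (show ¬ m + (i + 1 + d) < n + 1 by omega)]
  rcases lt_trichotomy (m + (i + 1 + d)) (n + i) with h2 | h2 | h2
  · rw [if_pos (by omega), if_pos (by omega), if_neg (by omega)]
    have : i + 1 + (i + 1 + d) - 2 * (m + (i + 1 + d) - n) =
      (i + (i + 1 + d) - 2 * (m + (i + 1 + d) - n)) + 1 := by omega
    rw [this]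
    ring
  · rw [if_pos (by omega), if_neg (by omega), if_neg (by omega)]
    have : i + 1 + (i + 1 + d) - 2 * (m + (i + 1 + d) - n) = d + 2 := by omega
    rw [this]
    ring
  · rw [if_neg (by omega), if_neg (by omega), if_pos (by omega)]
    ring

/-- Equation (3.12): for `2 ≤ i ≤ j ≤ p = ⌊(n+1)/2⌋`,
`C_{ij} - q C_{i-1,j}
  = q^(j-i) (1-q²) ( Σ_{k=0}^{j-i} (Jᵀ)^k + Σ_{m=1}^{i-1} q^(2m) J^m )`. -/
theorem Cij_row_reduction (n : ℕ) (hn : 3 ≤ n) (i j : ℕ)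
    (hi : 2 ≤ i) (hij : i ≤ j) (hj : j ≤ (n + 1) / 2) :
    Cmat n i j - q • Cmat n (i - 1) j =
      (q ^ (j - i) * (1 - q ^ 2)) •
        ((∑ k ∈ Finset.range (j - i + 1), ((Jmat n)ᵀ) ^ k) +
          ∑ m ∈ Finset.Icc 1 (i - 1), q ^ (2 * m) • (Jmat n) ^ m) := by
  obtain ⟨i, rfl⟩ : ∃ a, i = a + 1 := ⟨i - 1, by omega⟩
  obtain ⟨d, rfl⟩ := Nat.exists_eq_add_of_le hij
  have e1 : i + 1 + d - (i + 1) = d := by omega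
  rw [e1, Nat.add_sub_cancel]
  ext1 r c
  rw [Matrix.sub_apply, Matrix.smul_apply, Matrix.smul_apply, Matrix.add_apply,
    sumT n d (by omega), sumJ n i (by omega), smul_eq_mul, smul_eq_mul]
  exact firstRow_reduction n i d _ (c - r : Fin n).isLt (by omega) (by omega)
end
end

section
/- With V the q-Varchenko matrix of the cyclic model C_n and P as below, the congruence P V P^t equals the (1+np)×(1+np) block matrix whose (0,0) entry is 1, whose other blocks in block row 0 and block column 0 are zero, and whose (i,j) block equals (1 − q²)·q^{|i−j|}·J^{(i−j) mod n} for all 1 ≤ i, j ≤ p. -/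
open Matrix

noncomputable section

/-- Index type for the `(1+np) × (1+np)` block matrices of the cyclic model:
one scalar block index `0` (`Sum.inl`) and block indices `1, …, p`
(`Sum.inr (i, r)` with `i : Fin p` corresponding to the `1`-based block index `i+1`),
each block of size `n`. -/
abbrev CIdx (n p : ℕ) := Unit ⊕ (Fin p × Fin n)

/-- The `q`-Varchenko matrix `V` of the cyclic model `C_n` (Theorem 3.1):
`(0,0)` entry `1`, `(0,j)` block the all-`q^j` row vector `Q_j`, `(i,0)` block `Q_iᵀ`,
`(i,j)` block `C_{ij}` for `i ≤ j` and `C_{ji}ᵀ` for `i > j` (`1`-based block indices). -/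
def Vcyc (n p : ℕ) : Matrix (CIdx n p) (CIdx n p) (Polynomial ℤ) :=
  Matrix.of fun x y =>
    match x, y with
    | Sum.inl _, Sum.inl _ => 1
    | Sum.inl _, Sum.inr (j, _) => q ^ ((j : ℕ) + 1)
    | Sum.inr (i, _), Sum.inl _ => q ^ ((i : ℕ) + 1)
    | Sum.inr (i, r), Sum.inr (j, c) =>
        if (i : ℕ) ≤ (j : ℕ) then Cmat n ((i : ℕ) + 1) ((j : ℕ) + 1) r c
        else Cmat n ((j : ℕ) + 1) ((i : ℕ) + 1) c r

/-- The block matrix `P`: the identity, except that its `(1,0)` block is `-q·𝟙`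
(`𝟙` the all-ones column) and its `(k, k-1)` block is `-q·I_n` for `2 ≤ k ≤ p`
(`1`-based block indices). -/
def Pcyc (n p : ℕ) : Matrix (CIdx n p) (CIdx n p) (Polynomial ℤ) :=
  Matrix.of fun x y =>
    match x, y with
    | Sum.inl _, Sum.inl _ => 1
    | Sum.inl _, Sum.inr _ => 0
    | Sum.inr (i, _), Sum.inl _ => if (i : ℕ) = 0 then -q else 0
    | Sum.inr (i, r), Sum.inr (j, c) =>
        if i = j then (if r = c then 1 else 0)
        else if (i : ℕ) = (j : ℕ) + 1 then (if r = c then -q else 0)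
        else 0

/-- The block matrix `W` of (3.15): `(0,0)` entry `1`, the other blocks of block row
and block column `0` equal to zero, and `(i,j)` block `(1-q²) q^|i-j| J^((i-j) mod n)`. -/
def Wcyc (n p : ℕ) : Matrix (CIdx n p) (CIdx n p) (Polynomial ℤ) :=
  Matrix.of fun x y =>
    match x, y with
    | Sum.inl _, Sum.inl _ => 1
    | Sum.inl _, Sum.inr _ => 0
    | Sum.inr _, Sum.inl _ => 0
    | Sum.inr (i, r), Sum.inr (j, c) =>
        (((1 - q ^ 2) * q ^ (((i : ℤ) - (j : ℤ)).natAbs)) •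
          (Jmat n) ^ ((((i : ℤ) - (j : ℤ)) % (n : ℤ)).toNat)) r c

/-- exponent of `firstRow` -/
def expo (n i j m : ℕ) : ℕ :=
  if m < i then j - i + 2 * m
  else if m + j < n + 1 then i + j
  else if m + j < n + i then i + j - 2 * (m + j - n)
  else j - i

theorem firstRow_eq (n i j m : ℕ) : firstRow n i j m = q ^ expo n i j m := by
  unfold firstRow expo
  split_ifs <;> rfl

theorem expo_zero (n j m : ℕ) : expo n 0 j m = j := by
  unfold expo
  split_ifs <;> omega

theorem expo_lt (n i j m : ℕ) (hij : i < j) (hj : 2 * j + 1 ≤ n) (hm : m < n) :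
    (m + (j - i) = n ∧ expo n (i+1) (j+1) m = j - i ∧ expo n i (j+1) m + 1 = j - i + 2 ∧
      expo n (i+1) j m + 1 = j - i + 2 ∧ expo n i j m = j - i) ∨
    (m + (j - i) ≠ n ∧ expo n (i+1) (j+1) m = expo n i (j+1) m + 1 ∧
      expo n (i+1) j m + 1 = expo n i j m + 2) ∨
    (m + (j - i) ≠ n ∧ expo n (i+1) (j+1) m = expo n (i+1) j m + 1 ∧
      expo n i (j+1) m + 1 = expo n i j m + 2) := by
  unfold expo
  split_ifs <;> omega

theorem expo_diag (n i m m' : ℕ) (hj : 2 * i + 1 ≤ n) (hm : m < n)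
    (hm' : (m = 0 ∧ m' = 0) ∨ (m ≠ 0 ∧ m' + m = n)) :
    (m = 0 ∧ expo n (i+1) (i+1) m = 0 ∧ expo n i (i+1) m + 1 = 2 ∧
      expo n i (i+1) m' + 1 = 2 ∧ expo n i i m = 0) ∨
    (m ≠ 0 ∧ expo n (i+1) (i+1) m = expo n i (i+1) m + 1 ∧
      expo n i (i+1) m' + 1 = expo n i i m + 2) ∨
    (m ≠ 0 ∧ expo n (i+1) (i+1) m = expo n i (i+1) m' + 1 ∧
      expo n i (i+1) m + 1 = expo n i i m + 2) := by
  unfold expo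
  split_ifs <;> omega

theorem comb (a b c e d : ℕ) (D : Prop) [Decidable D]
    (h : (D ∧ a = d ∧ b + 1 = d + 2 ∧ c + 1 = d + 2 ∧ e = d) ∨
      (¬ D ∧ a = b + 1 ∧ c + 1 = e + 2) ∨ (¬ D ∧ a = c + 1 ∧ b + 1 = e + 2)) :
    q ^ a - q * q ^ b - q * (q ^ c - q * q ^ e) =
      ((1 - q ^ 2) * q ^ d) * (if D then 1 else 0) := by
  rcases h with ⟨h, rfl, h1, h2, rfl⟩ | ⟨h, rfl, h1⟩ | ⟨h, rfl, h1⟩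
  · obtain rfl : b = e + 1 := by omega
    obtain rfl : c = e + 1 := by omega
    rw [if_pos h]; ring
  · obtain rfl : c = e + 1 := by omega
    rw [if_neg h]; ring
  · obtain rfl : b = e + 1 := by omega
    rw [if_neg h]; ring

theorem sub_val (n : ℕ) (r c : Fin n) :
    ((c - r : Fin n) : ℕ) = if (r : ℕ) ≤ c then (c : ℕ) - r else n + c - r := by
  have hr := r.2
  have hc := c.2
  rw [Fin.val_sub]
  split_ifs with h
  · rw [show n - (r : ℕ) + c = (c - r) + n by omega, Nat.add_mod_right, Nat.mod_eq_of_lt]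
    omega
  · rw [Nat.mod_eq_of_lt] <;> omega

theorem Jpow (n k : ℕ) (r c : Fin n) :
    (Jmat n ^ k) r c = if (c : ℕ) = (r + k) % n then 1 else 0 := by
  have hn : 0 < n := r.pos
  induction k generalizing c with
  | zero =>
    simp [Matrix.one_apply, Fin.ext_iff, Nat.mod_eq_of_lt r.2, eq_comm]
  | succ k ih =>
    rw [pow_succ, Matrix.mul_apply,
      Finset.sum_eq_single (⟨(r + k) % n, Nat.mod_lt _ hn⟩ : Fin n)]
    · rw [ih]
      simp [Jmat, add_assoc]
    · intro b _ hb
      rw [ih, if_neg, zero_mul]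
      intro h
      exact hb (Fin.ext h)
    · simp

/-- extended entries -/
def G (n i j : ℕ) (r c : Fin n) : Polynomial ℤ :=
  if i ≤ j then q ^ expo n i j ((c - r : Fin n) : ℕ)
  else q ^ expo n j i ((r - c : Fin n) : ℕ)

theorem G_main (n i j : ℕ) (r c : Fin n) (hi : 2 * i + 1 ≤ n) (hj : 2 * j + 1 ≤ n) :
    G n (i+1) (j+1) r c - q * G n i (j+1) r c - q * (G n (i+1) j r c - q * G n i j r c) =
    ((1 - q ^ 2) * q ^ (((i : ℤ) - (j : ℤ)).natAbs)) *
      (if (c : ℕ) = (r + (((i : ℤ) - (j : ℤ)) % (n : ℤ)).toNat) % n then 1 else 0) := by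
  have hr := r.2
  have hc := c.2
  have h1 := sub_val n r c
  have h2 := sub_val n c r
  have hmod : ∀ k, k < n → (((r : ℕ) + k) % n = if r + k < n then (r : ℕ) + k else r + k - n) := by
    intro k hk
    split_ifs with h
    · exact Nat.mod_eq_of_lt h
    · rw [Nat.mod_eq_sub_mod (by omega), Nat.mod_eq_of_lt (by omega)]
  have m1 := (c - r).2
  have m2 := (r - c).2
  unfold G
  rcases lt_trichotomy i j with h | h | h
  · have ht : (((i : ℤ) - (j : ℤ)) % (n : ℤ)).toNat = n - (j - i) := by
      rw [← Int.add_emod_right, Int.emod_eq_of_lt] <;> omega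
    rw [ht, hmod _ (by omega), show ((i : ℤ) - (j : ℤ)).natAbs = j - i by omega]
    rw [if_pos (by omega), if_pos (by omega), if_pos (by omega), if_pos (by omega)]
    apply comb
    have := expo_lt n i j _ h hj m1
    have hD : ((c : ℕ) = if (r : ℕ) + (n - (j - i)) < n then (r : ℕ) + (n - (j - i))
        else r + (n - (j - i)) - n) ↔ ((c - r : Fin n) : ℕ) + (j - i) = n := by
      rw [h1]
      split_ifs <;> omega
    rw [hD]
    exact this
  · subst h
    rw [if_pos (by omega), if_pos (by omega), if_neg (by omega), if_pos (by omega)]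
    simp only [sub_self, Int.zero_emod, Int.toNat_zero, Int.natAbs_zero]
    apply comb
    have := expo_diag n i _ ((r - c : Fin n) : ℕ) hj m1 (by
      rw [h1, h2]; split_ifs <;> omega)
    have hD : ((c : ℕ) = ((r : ℕ) + 0) % n) ↔ ((c - r : Fin n) : ℕ) = 0 := by
      rw [h1, add_zero, Nat.mod_eq_of_lt hr]
      split_ifs <;> omega
    rw [hD]
    simpa using this
  · have ht : (((i : ℤ) - (j : ℤ)) % (n : ℤ)).toNat = i - j := by
      rw [Int.emod_eq_of_lt] <;> omega
    rw [ht, hmod _ (by omega), show ((i : ℤ) - (j : ℤ)).natAbs = i - j by omega]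
    have e1 : (if i ≤ j + 1 then q ^ expo n i (j+1) ((c - r : Fin n) : ℕ)
        else q ^ expo n (j+1) i ((r - c : Fin n) : ℕ)) = q ^ expo n (j+1) i ((r - c : Fin n) : ℕ) := by
      split_ifs with h'
      · obtain rfl : i = j + 1 := by omega
        congr 1
        rw [h1, h2]
        unfold expo
        split_ifs <;> omega
      · rfl
    rw [if_neg (by omega), e1, if_neg (by omega), if_neg (by omega)]
    apply comb
    have := expo_lt n j i _ h hi m2
    have hD : ((c : ℕ) = if (r : ℕ) + (i - j) < n then (r : ℕ) + (i - j)
        else r + (i - j) - n) ↔ ((r - c : Fin n) : ℕ) + (i - j) = n := by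
      rw [h2]
      split_ifs <;> omega
    rw [hD]
    tauto

/-- previous index -/
def prv {n p : ℕ} (i : Fin p) (r : Fin n) : CIdx n p :=
  if (i : ℕ) = 0 then Sum.inl () else Sum.inr (⟨i - 1, by omega⟩, r)

theorem P_row {n p : ℕ} (i : Fin p) (r : Fin n) (x : CIdx n p) :
    Pcyc n p (Sum.inr (i, r)) x =
      (if Sum.inr (i, r) = x then 1 else 0) + (if prv i r = x then -q else 0) := by
  unfold prv
  rcases x with u | ⟨j, c⟩
  · by_cases h : (i : ℕ) = 0 <;> simp [Pcyc, h]
  · by_cases h : (i : ℕ) = 0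
    · by_cases h2 : i = j
      · subst h2
        simp [Pcyc, h]
      · simp [Pcyc, h, h2]
    · by_cases h2 : i = j
      · subst h2
        have : ¬ ((i : ℕ) - 1 = i) := by omega
        simp [Pcyc, h, Fin.ext_iff, this]
      · have : ((i : ℕ) = j + 1) ↔ ((i : ℕ) - 1 = j) := by omega
        have h5 : ¬ ((i : ℕ) = j) := fun h => h2 (Fin.ext h)
        by_cases h3 : (i : ℕ) - 1 = j <;> by_cases h4 : (r : ℕ) = c <;>
          simp [Pcyc, h, h5, this, h3, h4, Fin.ext_iff]

theorem P_sum {n p : ℕ} (i : Fin p) (r : Fin n) (f : CIdx n p → Polynomial ℤ) :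
    ∑ x, Pcyc n p (Sum.inr (i, r)) x * f x = f (Sum.inr (i, r)) - q * f (prv i r) := by
  simp only [P_row, add_mul, Finset.sum_add_distrib, ite_mul, one_mul, zero_mul,
    Finset.sum_ite_eq, Finset.mem_univ, if_true]
  ring

theorem P_sum_zero {n p : ℕ} (u : Unit) (f : CIdx n p → Polynomial ℤ) :
    ∑ x, Pcyc n p (Sum.inl u) x * f x = f (Sum.inl ()) := by
  simp [Pcyc]

theorem congr_apply {n p : ℕ} (x y : CIdx n p) :
    (Pcyc n p * Vcyc n p * (Pcyc n p)ᵀ) x y =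
      ∑ b, Pcyc n p y b * ∑ a, Pcyc n p x a * Vcyc n p a b := by
  rw [Matrix.mul_apply]
  refine Finset.sum_congr rfl fun b _ => ?_
  rw [Matrix.mul_apply, Matrix.transpose_apply, mul_comm]

theorem V_rr {n p : ℕ} (i j : Fin p) (r c : Fin n) :
    Vcyc n p (Sum.inr (i, r)) (Sum.inr (j, c)) = G n (i+1) (j+1) r c := by
  simp [Vcyc, G, Cmat, firstRow_eq]

theorem V_pr {n p : ℕ} (i j : Fin p) (r c : Fin n) :
    Vcyc n p (prv i r) (Sum.inr (j, c)) = G n i (j+1) r c := by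
  unfold prv
  split_ifs with h
  · simp [Vcyc, G, h, expo_zero]
  · rw [V_rr]
    simp only
    rw [Nat.sub_add_cancel (by omega)]

theorem V_rp {n p : ℕ} (i j : Fin p) (r c : Fin n) :
    Vcyc n p (Sum.inr (i, r)) (prv j c) = G n (i+1) j r c := by
  unfold prv
  split_ifs with h
  · simp [Vcyc, G, h, expo_zero]
  · rw [V_rr]
    simp only
    rw [Nat.sub_add_cancel (by omega)]

theorem V_pp {n p : ℕ} (i j : Fin p) (r c : Fin n) :
    Vcyc n p (prv i r) (prv j c) = G n i j r c := by
  by_cases h : (j : ℕ) = 0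
  · by_cases h' : (i : ℕ) = 0
    · simp [prv, Vcyc, G, h, h', expo_zero]
    · simp [prv, Vcyc, G, h, h', expo_zero, Nat.sub_add_cancel (Nat.pos_of_ne_zero h')]
  · rw [prv.eq_def j, if_neg h, V_pr]
    simp only
    rw [Nat.sub_add_cancel (by omega)]

theorem V_zero_r {n p : ℕ} (j : Fin p) (c : Fin n) :
    Vcyc n p (Sum.inl ()) (Sum.inr (j, c)) = q * Vcyc n p (Sum.inl ()) (prv j c) := by
  unfold prv
  split_ifs with h
  · simp [Vcyc, h]
  · simp only [Vcyc, Matrix.of_apply, Nat.sub_add_cancel (Nat.pos_of_ne_zero h)]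
    exact pow_succ' _ _

theorem V_r_zero {n p : ℕ} (j : Fin p) (c : Fin n) :
    Vcyc n p (Sum.inr (j, c)) (Sum.inl ()) = q * Vcyc n p (prv j c) (Sum.inl ()) := by
  unfold prv
  split_ifs with h
  · simp [Vcyc, h]
  · simp only [Vcyc, Matrix.of_apply, Nat.sub_add_cancel (Nat.pos_of_ne_zero h)]
    exact pow_succ' _ _

/-- Equation (3.15): the congruence `P V Pᵀ` of the `q`-Varchenko matrix of the cyclic
model `C_n` equals the block matrix `W` whose `(0,0)` entry is `1`, whose remaining
blocks in block row `0` and block column `0` vanish, and whose `(i,j)` block is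
`(1-q²) q^|i-j| J^((i-j) mod n)` for `1 ≤ i, j ≤ p`. -/
theorem cyclic_congruence_P (n p : ℕ) (hn : 3 ≤ n) (hp : p = (n + 1) / 2) :
    Pcyc n p * Vcyc n p * (Pcyc n p)ᵀ = Wcyc n p := by
  ext1 x y
  rw [congr_apply]
  rcases x with u | ⟨i, r⟩ <;> rcases y with v | ⟨j, c⟩
  · simp only [P_sum_zero]
    rfl
  · simp only [P_sum_zero, P_sum]
    rw [V_zero_r, sub_self]
    rfl
  · simp only [P_sum_zero, P_sum]
    rw [V_r_zero, sub_self]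
    rfl
  · simp only [P_sum, V_rr, V_pr, V_rp, V_pp]
    have hi := i.2
    have hj := j.2
    rw [G_main n i j r c (by omega) (by omega)]
    simp only [Wcyc, Matrix.of_apply, Matrix.smul_apply, Jpow, smul_eq_mul]
end
end

section
/- Let W be the (1+np)×(1+np) block matrix over ℤ[q] with (0,0) entry 1, all other blocks in block row 0 and block column 0 zero, and (i,j) block equal to (1 − q²)·q^{|i−j|}·J^{(i−j) mod n} for 1 ≤ i, j ≤ p. Let S be the (1+np)×(1+np) block matrix equal to the identity except that its (k,k−1) block is −q·J for 2 ≤ k ≤ p. Then S W S^t = diag(1, (1−q²)·I_n, (1−q²)²·I_{n(p−1)}). -/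
open Matrix

noncomputable section

/-- The block matrix `S`: the identity, except that its `(k, k-1)` block is `-q·J`
for `2 ≤ k ≤ p` (`1`-based block indices). -/
def Scyc (n p : ℕ) : Matrix (CIdx n p) (CIdx n p) (Polynomial ℤ) :=
  Matrix.of fun x y =>
    match x, y with
    | Sum.inl _, Sum.inl _ => 1
    | Sum.inl _, Sum.inr _ => 0
    | Sum.inr _, Sum.inl _ => 0
    | Sum.inr (i, r), Sum.inr (j, c) =>
        if i = j then (if r = c then 1 else 0)
        else if (i : ℕ) = (j : ℕ) + 1 then -q * Jmat n r c
        else 0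

/-- The diagonal matrix `diag(1, (1-q²) I_n, (1-q²)² I_{n(p-1)})`: diagonal entry `1`
at the scalar index, `(1-q²)` on block `1`, and `(1-q²)²` on blocks `2, …, p`. -/
def Dcyc (n p : ℕ) : Matrix (CIdx n p) (CIdx n p) (Polynomial ℤ) :=
  Matrix.of fun x y =>
    match x, y with
    | Sum.inl _, Sum.inl _ => 1
    | Sum.inl _, Sum.inr _ => 0
    | Sum.inr _, Sum.inl _ => 0
    | Sum.inr (i, r), Sum.inr (j, c) =>
        if i = j ∧ r = c then (if (i : ℕ) = 0 then 1 - q ^ 2 else (1 - q ^ 2) ^ 2)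
        else 0

/-- The successor of `r` in the cyclic group of residues modulo `n`. -/
def nxt {n : ℕ} (r : Fin n) : Fin n :=
  ⟨((r : ℕ) + 1) % n, Nat.mod_lt _ (Nat.lt_of_le_of_lt (Nat.zero_le _) r.2)⟩

lemma Jmat_apply' {n : ℕ} (r c : Fin n) : Jmat n r c = if c = nxt r then 1 else 0 := by
  simp [Jmat, nxt, Fin.ext_iff]

lemma nxt_cast {n : ℕ} (r : Fin n) : (((nxt r : Fin n) : ℕ) : ZMod n) = (r : ℕ) + 1 := by
  simp [nxt]

lemma cast_inj' {n : ℕ} (r c : Fin n) : (((r : ℕ) : ZMod n) = ((c : ℕ) : ZMod n)) ↔ r = c := by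
  rw [ZMod.natCast_eq_natCast_iff', Nat.mod_eq_of_lt r.2, Nat.mod_eq_of_lt c.2, Fin.ext_iff]

lemma Jpow_apply {n : ℕ} (k : ℕ) : ∀ (r c : Fin n),
    (Jmat n ^ k) r c = if ((c : ℕ) : ZMod n) = (r : ℕ) + (k : ZMod n) then 1 else 0 := by
  induction k with
  | zero =>
    intro r c
    simp only [pow_zero, Matrix.one_apply, Nat.cast_zero, add_zero, cast_inj', eq_comm]
  | succ k ih =>
    intro r c
    rw [pow_succ', Matrix.mul_apply]
    simp only [Jmat_apply', ite_mul, one_mul, zero_mul, Finset.sum_ite_eq',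
      Finset.mem_univ, if_true]
    rw [ih, nxt_cast]
    have : ((r : ℕ) : ZMod n) + 1 + k = (r : ℕ) + ((k + 1 : ℕ) : ZMod n) := by push_cast; ring
    rw [this]

lemma W_apply {n p : ℕ} (hn : 3 ≤ n) (i j : Fin p) (r c : Fin n) :
    Wcyc n p (Sum.inr (i, r)) (Sum.inr (j, c)) =
      (1 - q ^ 2) * q ^ (((i : ℤ) - (j : ℤ)).natAbs) *
      if ((c : ℕ) : ZMod n) + ((j : ℕ) : ZMod n) = (r : ℕ) + ((i : ℕ) : ZMod n)
        then 1 else 0 := by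
  have h0 : 0 ≤ ((i : ℤ) - (j : ℤ)) % (n : ℤ) := Int.emod_nonneg _ (by omega)
  have h : (((((i : ℤ) - (j : ℤ)) % (n : ℤ)).toNat : ℕ) : ZMod n)
      = ((i : ℕ) : ZMod n) - ((j : ℕ) : ZMod n) := by
    rw [← Int.cast_natCast, Int.toNat_of_nonneg h0, ZMod.intCast_mod]
    push_cast; rfl
  simp only [Wcyc, Matrix.of_apply, Matrix.smul_apply, smul_eq_mul, Jpow_apply, h]
  congr 2
  rw [← add_sub_assoc, eq_sub_iff_add_eq]

lemma S_row_zero {n p : ℕ} (i : Fin p) (hi : (i : ℕ) = 0) (r : Fin n)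
    (f : CIdx n p → Polynomial ℤ) :
    ∑ y, Scyc n p (Sum.inr (i, r)) y * f y = f (Sum.inr (i, r)) := by
  rw [Finset.sum_eq_single (Sum.inr (i, r))]
  · simp [Scyc]
  · rintro (_ | ⟨j, c⟩) _ hne
    · simp [Scyc]
    · have h : ¬ (i : ℕ) = (j : ℕ) + 1 := by omega
      by_cases hij : i = j
      · subst hij
        have : ¬ r = c := by rintro rfl; exact hne rfl
        simp [Scyc, this]
      · simp [Scyc, hij, h]
  · simp

lemma S_row_succ {n p : ℕ} (i k : Fin p) (hi : (i : ℕ) = (k : ℕ) + 1) (r : Fin n)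
    (f : CIdx n p → Polynomial ℤ) :
    ∑ y, Scyc n p (Sum.inr (i, r)) y * f y
      = f (Sum.inr (i, r)) - q * f (Sum.inr (k, nxt r)) := by
  have hik : i ≠ k := by rintro rfl; omega
  rw [Finset.sum_eq_add (Sum.inr (i, r)) (Sum.inr (k, nxt r))]
  · simp [Scyc, hik, hi, Jmat_apply']
    ring
  · simp [hik]
  · rintro (_ | ⟨j, c⟩) _ ⟨h1, h2⟩
    · simp [Scyc]
    · by_cases hij : i = j
      · subst hij
        have : ¬ r = c := by rintro rfl; exact h1 rfl
        simp [Scyc, this]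
      · by_cases hj : (i : ℕ) = (j : ℕ) + 1
        · have : j = k := Fin.ext (by omega)
          subst this
          have : ¬ c = nxt r := by rintro rfl; exact h2 rfl
          simp [Scyc, hij, hj, Jmat_apply', this]
        · simp [Scyc, hij, hj]
  · simp
  · simp

lemma SWS_apply {n p : ℕ} (x y : CIdx n p) :
    (Scyc n p * Wcyc n p * (Scyc n p)ᵀ) x y
      = ∑ b, Scyc n p y b * ∑ a, Scyc n p x a * Wcyc n p a b := by
  rw [Matrix.mul_apply]
  refine Finset.sum_congr rfl fun b _ => ?_
  rw [Matrix.mul_apply, Matrix.transpose_apply, mul_comm]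

lemma S_row_inl {n p : ℕ} (u : Unit) (f : CIdx n p → Polynomial ℤ) :
    ∑ y, Scyc n p (Sum.inl u) y * f y = f (Sum.inl u) := by
  simp [Scyc]

/-- The result of applying the row operations `S` to `W`. -/
lemma SW_apply {n p : ℕ} (hn : 3 ≤ n) (i j : Fin p) (r c : Fin n) :
    ∑ a, Scyc n p (Sum.inr (i, r)) a * Wcyc n p a (Sum.inr (j, c)) =
      (if (i : ℕ) = 0 then (1 - q ^ 2) * q ^ (j : ℕ)
        else if (i : ℕ) ≤ (j : ℕ) then (1 - q ^ 2) ^ 2 * q ^ ((j : ℕ) - (i : ℕ)) else 0) *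
      if ((c : ℕ) : ZMod n) + ((j : ℕ) : ZMod n) = (r : ℕ) + ((i : ℕ) : ZMod n)
        then 1 else 0 := by
  rcases Nat.eq_zero_or_eq_succ_pred (i : ℕ) with hi | hi
  · rw [S_row_zero i hi, W_apply hn, if_pos hi]
    have : ((i : ℤ) - (j : ℤ)).natAbs = (j : ℕ) := by omega
    rw [this]
  · obtain ⟨m, hm⟩ : ∃ m, m = (i : ℕ).pred := ⟨_, rfl⟩
    rw [← hm, Nat.succ_eq_add_one] at hi
    have hk : m < p := by have := i.2; clear hm; omega
    rw [S_row_succ i ⟨m, hk⟩ hi, W_apply hn, W_apply hn, nxt_cast, if_neg (show ¬ (i : ℕ) = 0 by omega)]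
    have e : ((r : ℕ) : ZMod n) + 1 + (((⟨m, hk⟩ : Fin p) : ℕ) : ZMod n)
        = (r : ℕ) + ((i : ℕ) : ZMod n) := by rw [hi]; push_cast; ring
    rw [e]
    by_cases hij : (i : ℕ) ≤ (j : ℕ)
    · have h1 : ((i : ℤ) - (j : ℤ)).natAbs = (j : ℕ) - (i : ℕ) := by omega
      have h2 : ((((⟨m, hk⟩ : Fin p) : ℕ) : ℤ) - (j : ℤ)).natAbs = (j : ℕ) - (i : ℕ) + 1 := by
        simp only; omega
      rw [h1, h2, if_pos hij]
      split_ifs <;> ring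
    · have h2 : ((i : ℤ) - (j : ℤ)).natAbs
          = ((((⟨m, hk⟩ : Fin p) : ℕ) : ℤ) - (j : ℤ)).natAbs + 1 := by
        simp only; omega
      rw [h2, if_neg hij]
      split_ifs <;> ring

lemma main_inr {n p : ℕ} (hn : 3 ≤ n) (i j : Fin p) (r c : Fin n) :
    ∑ b, Scyc n p (Sum.inr (j, c)) b * ∑ a, Scyc n p (Sum.inr (i, r)) a * Wcyc n p a b
      = Dcyc n p (Sum.inr (i, r)) (Sum.inr (j, c)) := by
  have hD : Dcyc n p (Sum.inr (i, r)) (Sum.inr (j, c)) =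
      if i = j ∧ r = c then (if (i : ℕ) = 0 then 1 - q ^ 2 else (1 - q ^ 2) ^ 2) else 0 := rfl
  rw [hD]
  have hd : i = j → ((((c : ℕ) : ZMod n) + ((j : ℕ) : ZMod n)
      = (r : ℕ) + ((i : ℕ) : ZMod n)) ↔ r = c) := by
    rintro rfl
    rw [add_left_inj, cast_inj', eq_comm]
  rcases Nat.eq_zero_or_eq_succ_pred (j : ℕ) with hj | hj
  · rw [S_row_zero j hj, SW_apply hn]
    by_cases hij : i = j
    · simp only [hd hij]
      subst hij
      simp [hj]
    · have h : ¬ (i : ℕ) = 0 := fun h => hij (Fin.ext (by omega))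
      simp [hij, h, hj]
  · obtain ⟨m, hm⟩ : ∃ m, m = (j : ℕ).pred := ⟨_, rfl⟩
    rw [← hm, Nat.succ_eq_add_one] at hj
    have hk : m < p := by have := j.2; clear hm; omega
    rw [S_row_succ j ⟨m, hk⟩ hj, SW_apply hn, SW_apply hn, nxt_cast]
    have e : ((c : ℕ) : ZMod n) + 1 + (((⟨m, hk⟩ : Fin p) : ℕ) : ZMod n)
        = (c : ℕ) + ((j : ℕ) : ZMod n) := by rw [hj]; push_cast; ring
    rw [e]
    by_cases hij : i = j
    · simp only [hd hij]
      subst hij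
      have h0 : ¬ (i : ℕ) = 0 := by omega
      have h1 : ¬ (i : ℕ) ≤ m := by omega
      simp [h0, h1]
    · have hne : (i : ℕ) ≠ (j : ℕ) := fun h => hij (Fin.ext h)
      simp only [hij, false_and, if_false]
      by_cases h0 : (i : ℕ) = 0
      · simp only [h0, if_true, hj]
        split_ifs <;> ring
      · by_cases h1 : (i : ℕ) ≤ m
        · have h2 : (i : ℕ) ≤ (j : ℕ) := by omega
          have h3 : (j : ℕ) - (i : ℕ) = m - (i : ℕ) + 1 := by omega
          simp only [h0, h1, h2, h3, if_true, if_false]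
          split_ifs <;> ring
        · have h2 : ¬ (i : ℕ) ≤ (j : ℕ) := by omega
          simp [h0, h1, h2]

/-- The congruence by `S` takes the matrix `W` of (3.15) to the Smith normal form
`diag(1, (1-q²) I_n, (1-q²)² I_{n(p-1)})`. -/
theorem cyclic_congruence_S (n p : ℕ) (hn : 3 ≤ n) (hp : p = (n + 1) / 2) :
    Scyc n p * Wcyc n p * (Scyc n p)ᵀ = Dcyc n p := by
  ext1 x y
  rw [SWS_apply]
  rcases x with u | ⟨i, r⟩
  · simp only [S_row_inl]
    rcases y with v | ⟨j, c⟩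
    · rw [S_row_inl]; rfl
    · refine Finset.sum_eq_zero ?_ |>.trans rfl
      rintro (_ | ⟨k, d⟩) _ <;> simp [Scyc, Wcyc]
  · rcases y with v | ⟨j, c⟩
    · rw [S_row_inl]
      refine Finset.sum_eq_zero ?_ |>.trans rfl
      rintro (_ | ⟨k, d⟩) _ <;> simp [Scyc, Wcyc]
    · exact main_inr hn i j r c
end
end

section
/- For every n ≥ 3, with V the q-Varchenko matrix of the cyclic model C_n and P, S as below: (S P) V (S P)^t = diag(1, (1−q²)·I_n, (1−q²)²·I_{n(p−1)}), and det(S P) = 1. Consequently the q-Varchenko matrix of the cyclic model arrangement has Smith normal form diag(1, (1−q²)I_n, (1−q²)²I_{n(p−1)}) over ℤ[q], realized by a congruence over ℤ[q]. -/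
open Matrix

noncomputable section

/-! ### Helper lemmas -/

def hD (n r c : ℕ) : ℕ := if r ≤ c then c - r else n + c - r

def he (n i j m : ℕ) : ℕ :=
  if m < i then j - i + 2 * m
  else if m + j < n + 1 then i + j
  else if m + j < n + i then i + j - 2 * (m + j - n)
  else j - i

def hee (n i j r c : ℕ) : ℕ :=
  if i ≤ j then he n i j (hD n r c) else he n j i (hD n c r)

def hcond (n i j r c : ℕ) : Prop :=
  c + j = r + i ∨ c + j + n = r + i ∨ c + j = r + i + n

instance (n i j r c : ℕ) : Decidable (hcond n i j r c) := by
  unfold hcond; infer_instance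

def hw (n i j r c : ℕ) : Polynomial ℤ :=
  if hcond n i j r c then (1 - q ^ 2) * q ^ ((i - j) + (j - i)) else 0

lemma h_sub_val {n : ℕ} (r c : Fin n) : ((c - r : Fin n) : ℕ) = hD n r c := by
  have hr := r.2
  have hc := c.2
  rw [Fin.sub_def]
  simp only [hD]
  split_ifs with h
  · have : n - (r : ℕ) + c = (c - r) + n := by omega
    rw [this, Nat.add_mod_right, Nat.mod_eq_of_lt (by omega)]
  · rw [Nat.mod_eq_of_lt (by omega)]; omega

lemma h_firstRow (n i j m : ℕ) : firstRow n i j m = q ^ he n i j m := by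
  unfold firstRow he
  split_ifs <;> rfl

lemma hee_zero_left (n j r c : ℕ) : hee n 0 j r c = j := by
  unfold hee he
  split_ifs <;> omega

lemma hee_zero_right (n i r c : ℕ) : hee n i 0 r c = i := by
  unfold hee he
  split_ifs <;> omega

lemma hV_inr {n p : ℕ} (i j : Fin p) (r c : Fin n) :
    Vcyc n p (Sum.inr (i, r)) (Sum.inr (j, c)) = q ^ hee n (i + 1) (j + 1) r c := by
  simp only [Vcyc, Matrix.of_apply, Cmat, h_sub_val, h_firstRow, hee]
  split_ifs <;> first | rfl | omega

lemma h_symm (n i j r c : ℕ) (h : i = j → r < n ∧ c < n) (hh : 2 * i ≤ n + 1) :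
    hee n i j r c = hee n j i c r := by
  unfold hee
  rcases lt_trichotomy i j with h1 | h1 | h1
  · rw [if_pos h1.le, if_neg (by omega)]
  · subst h1
    have := h rfl
    simp only [le_refl, if_true]
    unfold he hD
    split_ifs <;> omega
  · rw [if_neg (by omega), if_pos h1.le]

lemma h_exp_lt (n i j m : ℕ) (hm : m < n) (hij : i < j) (hj : 2 * (j + 1) ≤ n + 1) :
    (m = n + i - j ∧ he n (i + 1) (j + 1) m = j - i ∧ he n i (j + 1) m = j - i + 1 ∧
      he n (i + 1) j m = j - i + 1 ∧ he n i j m = j - i) ∨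
    (m ≠ n + i - j ∧
      ((he n (i + 1) (j + 1) m = he n i (j + 1) m + 1 ∧ he n (i + 1) j m = he n i j m + 1) ∨
       (he n (i + 1) (j + 1) m = he n (i + 1) j m + 1 ∧ he n i (j + 1) m = he n i j m + 1))) := by
  unfold he
  split_ifs <;> omega

lemma h_exp_eq (n i r c : ℕ) (hr : r < n) (hc : c < n) (hj : 2 * (i + 1) ≤ n + 1) :
    (r = c ∧ hee n (i + 1) (i + 1) r c = 0 ∧ hee n i (i + 1) r c = 1 ∧
      hee n (i + 1) i r c = 1 ∧ hee n i i r c = 0) ∨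
    (r ≠ c ∧
      ((hee n (i + 1) (i + 1) r c = hee n i (i + 1) r c + 1 ∧
          hee n (i + 1) i r c = hee n i i r c + 1) ∨
       (hee n (i + 1) (i + 1) r c = hee n (i + 1) i r c + 1 ∧
          hee n i (i + 1) r c = hee n i i r c + 1))) := by
  have h1 : i ≤ i + 1 := by omega
  have h2 : ¬ (i + 1 ≤ i) := by omega
  simp only [hee, h1, h2, le_refl, if_true, if_false]
  have hD1 : (r = c ∧ hD n r c = 0 ∧ hD n c r = 0) ∨
      (r ≠ c ∧ 0 < hD n r c ∧ 0 < hD n c r ∧ hD n r c + hD n c r = n) := by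
    unfold hD
    split_ifs <;> omega
  generalize hD n r c = m at *
  generalize hD n c r = m' at *
  rcases hD1 with ⟨h, rfl, rfl⟩ | ⟨h, hm, hm', rfl⟩
  · left
    refine ⟨h, ?_⟩
    unfold he
    refine ⟨?_, ?_, ?_, ?_⟩ <;> split_ifs <;> omega
  · right
    refine ⟨h, ?_⟩
    unfold he
    rcases lt_trichotomy m i with h1 | h1 | h1 <;> rcases lt_trichotomy m' i with h2 | h2 | h2 <;>
    first
    | omega
    | left; constructor <;> split_ifs <;> omega
    | right; constructor <;> split_ifs <;> omega

lemma h_key_lt (n i j r c : ℕ) (hr : r < n) (hc : c < n) (hij : i < j)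
    (hj : 2 * (j + 1) ≤ n + 1) :
    q ^ hee n (i + 1) (j + 1) r c - q * q ^ hee n i (j + 1) r c
      - q * (q ^ hee n (i + 1) j r c - q * q ^ hee n i j r c) = hw n i j r c := by
  have e1 : i + 1 ≤ j + 1 := by omega
  have e2 : i ≤ j + 1 := by omega
  have e3 : i + 1 ≤ j := by omega
  have e4 : i ≤ j := by omega
  have hm : hD n r c < n := by unfold hD; split_ifs <;> omega
  have hcd : hcond n i j r c ↔ hD n r c = n + i - j := by
    unfold hcond hD; split_ifs <;> omega
  simp only [hee, e1, e2, e3, e4, if_true, hw, hcd]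
  rcases h_exp_lt n i j (hD n r c) hm hij hj with ⟨h, ha, hb, hc, hd⟩ | ⟨h, ⟨ha, hb⟩ | ⟨ha, hb⟩⟩
  · rw [if_pos h, ha, hb, hc, hd]
    have : i - j + (j - i) = j - i := by omega
    rw [this]; ring
  · rw [if_neg h, ha, hb]; ring
  · rw [if_neg h, ha, hb]; ring

lemma h_key_eq (n i r c : ℕ) (hr : r < n) (hc : c < n) (hj : 2 * (i + 1) ≤ n + 1) :
    q ^ hee n (i + 1) (i + 1) r c - q * q ^ hee n i (i + 1) r c
      - q * (q ^ hee n (i + 1) i r c - q * q ^ hee n i i r c) = hw n i i r c := by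
  have hcd : hcond n i i r c ↔ r = c := by
    unfold hcond; omega
  simp only [hw, hcd]
  rcases h_exp_eq n i r c hr hc hj with ⟨h, ha, hb, hc, hd⟩ | ⟨h, ⟨ha, hb⟩ | ⟨ha, hb⟩⟩
  · rw [if_pos h, ha, hb, hc, hd]
    simp only [Nat.sub_self]; ring
  · rw [if_neg h, ha, hb]; ring
  · rw [if_neg h, ha, hb]; ring

lemma hw_symm (n i j r c : ℕ) : hw n i j r c = hw n j i c r := by
  have : hcond n i j r c ↔ hcond n j i c r := by unfold hcond; omega
  simp only [hw, this, add_comm (i - j)]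

lemma h_key (n i j r c : ℕ) (hr : r < n) (hc : c < n)
    (hi : 2 * (i + 1) ≤ n + 1) (hj : 2 * (j + 1) ≤ n + 1) :
    q ^ hee n (i + 1) (j + 1) r c - q * q ^ hee n i (j + 1) r c
      - q * (q ^ hee n (i + 1) j r c - q * q ^ hee n i j r c) = hw n i j r c := by
  rcases lt_trichotomy i j with h | h | h
  · exact h_key_lt n i j r c hr hc h hj
  · subst h; exact h_key_eq n i r c hr hc hi
  · rw [hw_symm, ← h_key_lt n j i c r hc hr h hi,
      h_symm n (i + 1) (j + 1) r c (fun _ => ⟨hr, hc⟩) hi,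
      h_symm n i (j + 1) r c (fun _ => ⟨hr, hc⟩) (by omega),
      h_symm n (i + 1) j r c (fun _ => ⟨hr, hc⟩) hi,
      h_symm n i j r c (fun _ => ⟨hr, hc⟩) (by omega)]
    ring

/-- A row operation. -/
lemma h_row {ι : Type*} [Fintype ι] [DecidableEq ι] (A M : Matrix ι ι (Polynomial ℤ))
    (x z w : ι) (a : Polynomial ℤ)
    (hA : ∀ y, A x y = (if x = y then 1 else 0) + a * (if z = y then 1 else 0)) :
    (A * M) x w = M x w + a * M z w := by
  simp only [Matrix.mul_apply, hA, add_mul, Finset.sum_add_distrib, mul_assoc, ite_mul, one_mul,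
    zero_mul, mul_ite, mul_zero, Finset.sum_ite_eq, Finset.mem_univ, if_true]

/-- The predecessor of an index used by `P`. -/
def hpre {n p : ℕ} (i : Fin p) (r : Fin n) : CIdx n p :=
  if (i : ℕ) = 0 then Sum.inl () else Sum.inr (⟨i - 1, by omega⟩, r)

lemma hP_inl {n p : ℕ} (M : Matrix (CIdx n p) (CIdx n p) (Polynomial ℤ)) (u : Unit)
    (w : CIdx n p) : (Pcyc n p * M) (Sum.inl u) w = M (Sum.inl u) w := by
  rw [h_row (Pcyc n p) M (Sum.inl u) (Sum.inl u) w 0]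
  · simp
  · rintro (y | ⟨j, c⟩) <;> simp [Pcyc]

lemma hP_inr {n p : ℕ} (M : Matrix (CIdx n p) (CIdx n p) (Polynomial ℤ)) (i : Fin p) (r : Fin n)
    (w : CIdx n p) : (Pcyc n p * M) (Sum.inr (i, r)) w =
      M (Sum.inr (i, r)) w - q * M (hpre i r) w := by
  rw [h_row (Pcyc n p) M (Sum.inr (i, r)) (hpre i r) w (-q)]
  · ring
  · rintro (y | ⟨j, c⟩)
    · simp only [Pcyc, Matrix.of_apply, hpre]
      split_ifs <;> simp_all
    · simp only [Pcyc, Matrix.of_apply, hpre]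
      by_cases h0 : (i : ℕ) = 0
      · simp only [h0, if_true, Sum.inr.injEq, Prod.mk.injEq]
        simp
        split_ifs <;> simp_all
      · simp only [h0, if_false, Sum.inr.injEq, Prod.mk.injEq, Fin.ext_iff]
        split_ifs <;> first | omega | simp

lemma hV_pre {n p : ℕ} (i : Fin p) (r : Fin n) (j : Fin p) (c : Fin n) :
    Vcyc n p (hpre i r) (Sum.inr (j, c)) = q ^ hee n i (j + 1) r c := by
  unfold hpre
  split_ifs with h
  · rw [h, hee_zero_left]; rfl
  · rw [hV_inr]
    have : (i : ℕ) - 1 + 1 = i := by omega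
    simp only [this]

lemma hV_inl {n p : ℕ} (u : Unit) (j : Fin p) (c : Fin n) :
    Vcyc n p (Sum.inl u) (Sum.inr (j, c)) = q ^ ((j : ℕ) + 1) := rfl

lemma hV_inl' {n p : ℕ} (u : Unit) (j : Fin p) (c : Fin n) :
    Vcyc n p (Sum.inr (j, c)) (Sum.inl u) = q ^ ((j : ℕ) + 1) := rfl

lemma hV_pre' {n p : ℕ} (i : Fin p) (r : Fin n) (j : Fin p) (c : Fin n) :
    Vcyc n p (Sum.inr (i, r)) (hpre j c) = q ^ hee n (i + 1) j r c := by
  unfold hpre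
  split_ifs with h
  · rw [h, hee_zero_right]; rfl
  · rw [hV_inr]
    have : (j : ℕ) - 1 + 1 = j := by omega
    simp only [this]

lemma hV_inl_pre {n p : ℕ} (u : Unit) (j : Fin p) (c : Fin n) :
    Vcyc n p (Sum.inl u) (hpre j c) = q ^ (j : ℕ) := by
  unfold hpre
  split_ifs with h
  · rw [h]; simp [Vcyc]
  · rw [hV_inl]
    have : (j : ℕ) - 1 + 1 = j := by omega
    simp only [this]

lemma hV_pre_inl {n p : ℕ} (u : Unit) (j : Fin p) (c : Fin n) :
    Vcyc n p (hpre j c) (Sum.inl u) = q ^ (j : ℕ) := by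
  unfold hpre
  split_ifs with h
  · rw [h]; simp [Vcyc]
  · rw [hV_inl']
    have : (j : ℕ) - 1 + 1 = j := by omega
    simp only [this]

lemma hV_pre_pre {n p : ℕ} (i : Fin p) (r : Fin n) (j : Fin p) (c : Fin n) :
    Vcyc n p (hpre i r) (hpre j c) = q ^ hee n i j r c := by
  by_cases h : (i : ℕ) = 0
  · have : hpre i r = (Sum.inl () : CIdx n p) := by simp [hpre, h]
    rw [this, hV_inl_pre, h, hee_zero_left]
  · have : hpre i r = (Sum.inr (⟨i - 1, by omega⟩, r) : CIdx n p) := by simp [hpre, h]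
    rw [this, hV_pre']
    have : (i : ℕ) - 1 + 1 = i := by omega
    simp only [this]

/-- The matrix `P V Pᵀ`, written entrywise. -/
def hW (n p : ℕ) : Matrix (CIdx n p) (CIdx n p) (Polynomial ℤ) :=
  Matrix.of fun x y =>
    match x, y with
    | Sum.inl _, Sum.inl _ => 1
    | Sum.inl _, Sum.inr _ => 0
    | Sum.inr _, Sum.inl _ => 0
    | Sum.inr (i, r), Sum.inr (j, c) => hw n i j r c

lemma h_mul_transpose {ι : Type*} [Fintype ι] (A M : Matrix ι ι (Polynomial ℤ)) (x y : ι) :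
    (M * Aᵀ) x y = (A * Mᵀ) y x := by
  rw [← Matrix.transpose_apply (A * Mᵀ), Matrix.transpose_mul, Matrix.transpose_transpose]

lemma h_PVP (n p : ℕ) (hp : 2 * p ≤ n + 1) : Pcyc n p * Vcyc n p * (Pcyc n p)ᵀ = hW n p := by
  ext1 x y
  rw [h_mul_transpose]
  rcases x with u | ⟨i, r⟩ <;> rcases y with v | ⟨j, c⟩
  · rw [hP_inl, Matrix.transpose_apply, hP_inl]; rfl
  · rw [hP_inr, Matrix.transpose_apply, Matrix.transpose_apply, hP_inl, hP_inl, hV_inl,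
      hV_inl_pre]
    simp only [hW, Matrix.of_apply]; ring
  · rw [hP_inl, Matrix.transpose_apply, hP_inr, hV_inl', hV_pre_inl]
    simp only [hW, Matrix.of_apply]; ring
  · rw [hP_inr, Matrix.transpose_apply, Matrix.transpose_apply, hP_inr, hP_inr, hV_inr, hV_pre,
      hV_pre', hV_pre_pre]
    simp only [hW, Matrix.of_apply]
    exact h_key n i j r c r.2 c.2 (by omega) (by omega)

/-- Cyclic successor of `r`. -/
def hsuc {n : ℕ} (r : Fin n) : Fin n := ⟨(r + 1) % n, Nat.mod_lt _ (Fin.pos r)⟩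

lemma hsuc_val {n : ℕ} (r : Fin n) :
    ((r : ℕ) + 1 < n ∧ (hsuc r : ℕ) = r + 1) ∨ ((r : ℕ) + 1 = n ∧ (hsuc r : ℕ) = 0) := by
  have := r.2
  by_cases h : (r : ℕ) + 1 = n
  · right; exact ⟨h, by simp [hsuc, h]⟩
  · left
    have h' : (r : ℕ) + 1 < n := by omega
    exact ⟨h', by simp [hsuc, Nat.mod_eq_of_lt h']⟩

lemma hS_inl {n p : ℕ} (M : Matrix (CIdx n p) (CIdx n p) (Polynomial ℤ)) (u : Unit)
    (w : CIdx n p) : (Scyc n p * M) (Sum.inl u) w = M (Sum.inl u) w := by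
  rw [h_row (Scyc n p) M (Sum.inl u) (Sum.inl u) w 0]
  · simp
  · rintro (y | ⟨j, c⟩) <;> simp [Scyc]

lemma hS_zero {n p : ℕ} (M : Matrix (CIdx n p) (CIdx n p) (Polynomial ℤ)) (i : Fin p) (r : Fin n)
    (hi : (i : ℕ) = 0)
    (w : CIdx n p) : (Scyc n p * M) (Sum.inr (i, r)) w = M (Sum.inr (i, r)) w := by
  rw [h_row (Scyc n p) M (Sum.inr (i, r)) (Sum.inr (i, r)) w 0]
  · simp
  · rintro (y | ⟨j, c⟩)
    · simp [Scyc]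
    · simp only [Scyc, Matrix.of_apply, hi, Sum.inr.injEq, Prod.mk.injEq]
      simp
      split_ifs <;> simp_all

lemma hS_succ {n p : ℕ} (M : Matrix (CIdx n p) (CIdx n p) (Polynomial ℤ)) (i i' : Fin p)
    (r : Fin n) (hi : (i : ℕ) = i' + 1)
    (w : CIdx n p) : (Scyc n p * M) (Sum.inr (i, r)) w =
      M (Sum.inr (i, r)) w - q * M (Sum.inr (i', hsuc r)) w := by
  rw [h_row (Scyc n p) M (Sum.inr (i, r)) (Sum.inr (i', hsuc r)) w (-q)]
  · ring
  · rintro (y | ⟨j, c⟩)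
    · simp [Scyc]
    · simp only [Scyc, Matrix.of_apply, Sum.inr.injEq, Prod.mk.injEq, Fin.ext_iff, Jmat, hsuc]
      split_ifs <;> first | omega | simp

lemma hw_apply {n p : ℕ} (i j : Fin p) (r c : Fin n) :
    hW n p (Sum.inr (i, r)) (Sum.inr (j, c)) = hw n i j r c := rfl

lemma hcond_succ_left {n : ℕ} (i j : ℕ) (r : Fin n) (c : ℕ) (hi : i + 1 < n) (hj : j < n)
    (hc : c < n) : hcond n i j (hsuc r) c ↔ hcond n (i + 1) j r c := by
  have := r.2
  have := hsuc_val r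
  unfold hcond
  omega

lemma hcond_succ_right {n : ℕ} (i j : ℕ) (r : ℕ) (c : Fin n) (hi : i < n) (hj : j + 1 < n)
    (hr : r < n) : hcond n i j r (hsuc c) ↔ hcond n i (j + 1) r c := by
  have := c.2
  have := hsuc_val c
  unfold hcond
  omega

lemma h_SWS (n p : ℕ) (hp : p < n) : Scyc n p * hW n p * (Scyc n p)ᵀ = Dcyc n p := by
  ext1 x y
  rw [h_mul_transpose]
  rcases x with u | ⟨i, r⟩ <;> rcases y with v | ⟨j, c⟩
  · rw [hS_inl, Matrix.transpose_apply, hS_inl]; rfl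
  · have hz : ∀ j c, hW n p (Sum.inl u) (Sum.inr (j, c)) = 0 := fun _ _ => rfl
    have hD0 : Dcyc n p (Sum.inl u) (Sum.inr (j, c)) = 0 := rfl
    rcases Nat.eq_zero_or_pos (j : ℕ) with hj | hj
    · rw [hS_zero _ _ _ hj, Matrix.transpose_apply, hS_inl, hz, hD0]
    · rw [hS_succ _ j ⟨j - 1, by omega⟩ c (by simp; omega), Matrix.transpose_apply,
        Matrix.transpose_apply, hS_inl, hS_inl, hz, hz, hD0]
      ring
  · have hz : ∀ j c, hW n p (Sum.inr (j, c)) (Sum.inl v) = 0 := fun _ _ => rfl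
    have hD0 : Dcyc n p (Sum.inr (i, r)) (Sum.inl v) = 0 := rfl
    rw [hS_inl, Matrix.transpose_apply]
    rcases Nat.eq_zero_or_pos (i : ℕ) with hj | hj
    · rw [hS_zero _ _ _ hj, hz, hD0]
    · rw [hS_succ _ i ⟨i - 1, by omega⟩ r (by simp; omega), hz, hz, hD0]
      ring
  · have hr := r.2
    have hc := c.2
    have hi2 := i.2
    have hj2 := j.2
    have hDD : Dcyc n p (Sum.inr (i, r)) (Sum.inr (j, c)) =
      if (i : ℕ) = j ∧ (r : ℕ) = c then (if (i : ℕ) = 0 then 1 - q ^ 2 else (1 - q ^ 2) ^ 2)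
        else 0 := by
      simp only [Dcyc, Matrix.of_apply, Fin.ext_iff]
    rw [hDD]
    rcases Nat.eq_zero_or_pos (j : ℕ) with hj | hj <;>
      rcases Nat.eq_zero_or_pos (i : ℕ) with hi | hi
    · rw [hS_zero _ _ _ hj, Matrix.transpose_apply, hS_zero _ _ _ hi, hw_apply, hi, hj]
      have : hcond n 0 0 r c ↔ (r : ℕ) = c := by unfold hcond; omega
      simp [hw, this]
    · obtain ⟨k, hk⟩ : ∃ k, (i : ℕ) = k + 1 := ⟨i - 1, by omega⟩
      rw [hS_zero _ _ _ hj, Matrix.transpose_apply, hS_succ _ i ⟨k, by omega⟩ r hk,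
        hw_apply, hw_apply, hk, hj, if_neg (by omega)]
      simp only [hw, hcond_succ_left k 0 r c (by omega) (by omega) hc]
      split_ifs
      · simp; ring
      · ring
    · obtain ⟨k, hk⟩ : ∃ k, (j : ℕ) = k + 1 := ⟨j - 1, by omega⟩
      rw [hS_succ _ j ⟨k, by omega⟩ c hk, Matrix.transpose_apply, Matrix.transpose_apply,
        hS_zero _ _ _ hi, hS_zero _ _ _ hi,
        hw_apply, hw_apply, hk, hi, if_neg (by omega)]
      simp only [hw, hcond_succ_right 0 k r c (by omega) (by omega) hr]
      split_ifs
      · simp; ring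
      · ring
    · obtain ⟨k, hk⟩ : ∃ k, (j : ℕ) = k + 1 := ⟨j - 1, by omega⟩
      obtain ⟨l, hl⟩ : ∃ l, (i : ℕ) = l + 1 := ⟨i - 1, by omega⟩
      rw [hS_succ _ j ⟨k, by omega⟩ c hk, Matrix.transpose_apply, Matrix.transpose_apply,
        hS_succ _ i ⟨l, by omega⟩ r hl, hS_succ _ i ⟨l, by omega⟩ r hl,
        hw_apply, hw_apply, hw_apply, hw_apply, hk, hl]
      simp only [hw, hcond_succ_right (l + 1) k r c (by omega) (by omega) hr,
        hcond_succ_right l k (hsuc r) c (by omega) (by omega) (hsuc r).2,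
        hcond_succ_left l (k + 1) r c (by omega) (by omega) hc]
      have hne : ¬ (l + 1 = 0) := by omega
      rw [if_neg hne]
      by_cases hcd : hcond n (l + 1) (k + 1) r c
      · simp only [if_pos hcd]
        rcases lt_trichotomy l k with h | h | h
        · rw [if_neg (by omega)]
          obtain ⟨d, rfl⟩ : ∃ d, k = l + 1 + d := ⟨k - (l + 1), by omega⟩
          have a1 : l + 1 - (l + 1 + d + 1) + (l + 1 + d + 1 - (l + 1)) = d + 1 := by omega
          have a2 : l - (l + 1 + d + 1) + (l + 1 + d + 1 - l) = d + 2 := by omega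
          have a3 : l + 1 - (l + 1 + d) + (l + 1 + d - (l + 1)) = d := by omega
          have a4 : l - (l + 1 + d) + (l + 1 + d - l) = d + 1 := by omega
          rw [a1, a2, a3, a4]; ring
        · subst h
          have hrc : (r : ℕ) = c := by unfold hcond at hcd; omega
          rw [if_pos ⟨rfl, hrc⟩]
          have a2 : l - (l + 1) + (l + 1 - l) = 1 := by omega
          have a3 : l + 1 - l + (l - (l + 1)) = 1 := by omega
          rw [a2, a3]; simp only [Nat.sub_self]; ring
        · rw [if_neg (by omega)]
          obtain ⟨d, rfl⟩ : ∃ d, l = k + 1 + d := ⟨l - (k + 1), by omega⟩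
          have a1 : k + 1 + d + 1 - (k + 1) + (k + 1 - (k + 1 + d + 1)) = d + 1 := by omega
          have a2 : k + 1 + d - (k + 1) + (k + 1 - (k + 1 + d)) = d := by omega
          have a3 : k + 1 + d + 1 - k + (k - (k + 1 + d + 1)) = d + 2 := by omega
          have a4 : k + 1 + d - k + (k - (k + 1 + d)) = d + 1 := by omega
          rw [a1, a2, a3, a4]; ring
      · simp only [if_neg hcd]
        rw [if_neg (by
          rintro ⟨h1, h2⟩
          apply hcd
          unfold hcond
          omega)]
        ring

/-- Block level of an index. -/
def hlev {n p : ℕ} : CIdx n p → ℕᵒᵈ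
  | Sum.inl _ => OrderDual.toDual 0
  | Sum.inr (i, _) => OrderDual.toDual ((i : ℕ) + 1)

lemma h_det {n p : ℕ} (A : Matrix (CIdx n p) (CIdx n p) (Polynomial ℤ))
    (h1 : A.BlockTriangular hlev)
    (h2 : ∀ x y, hlev x = hlev y → A x y = if x = y then 1 else 0) : A.det = 1 := by
  rw [h1.det]
  apply Finset.prod_eq_one
  intro a _
  have : A.toSquareBlock hlev a = 1 := by
    ext1 x y
    rw [Matrix.toSquareBlock_def, Matrix.of_apply, h2 _ _ (x.2.trans y.2.symm), Matrix.one_apply]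
    simp only [Subtype.ext_iff]
  rw [this, Matrix.det_one]

lemma h_detP (n p : ℕ) : (Pcyc n p).det = 1 := by
  apply h_det
  · rintro (u | ⟨i, r⟩) (v | ⟨j, c⟩) h <;> simp [hlev, Pcyc, Fin.ext_iff] at h ⊢
    · exact absurd (show (i : ℕ) + 1 < 0 from h) (by omega)
    have h1 : ¬ ((i : ℕ) = j) := by omega
    have h2 : ¬ ((i : ℕ) = j + 1) := by omega
    simp [h1, h2]
  · rintro (u | ⟨i, r⟩) (v | ⟨j, c⟩) h <;> simp [hlev, Pcyc, Fin.ext_iff] at h ⊢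
    simp [h]

lemma h_detS (n p : ℕ) : (Scyc n p).det = 1 := by
  apply h_det
  · rintro (u | ⟨i, r⟩) (v | ⟨j, c⟩) h <;> simp [hlev, Scyc, Fin.ext_iff] at h ⊢
    have h1 : ¬ ((i : ℕ) = j) := by omega
    have h2 : ¬ ((i : ℕ) = j + 1) := by omega
    simp [h1, h2]
  · rintro (u | ⟨i, r⟩) (v | ⟨j, c⟩) h <;> simp [hlev, Scyc, Fin.ext_iff] at h ⊢
    simp [h]

/-- **Theorem 3.2.**  For every `n ≥ 3`, the congruence `(SP) V (SP)ᵀ` of the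
`q`-Varchenko matrix of the cyclic model `C_n` equals
`diag(1, (1-q²) I_n, (1-q²)² I_{n(p-1)})`, and `det (SP) = 1`; hence this diagonal
matrix is the Smith normal form of `V` over `ℤ[q]`, realized by a congruence over
`ℤ[q]`. -/
theorem cyclic_snf (n p : ℕ) (hn : 3 ≤ n) (hp : p = (n + 1) / 2) :
    (Scyc n p * Pcyc n p) * Vcyc n p * (Scyc n p * Pcyc n p)ᵀ = Dcyc n p ∧
      (Scyc n p * Pcyc n p).det = 1 := by
  refine ⟨?_, ?_⟩
  · rw [← h_SWS n p (by omega), ← h_PVP n p (by omega), Matrix.transpose_mul]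
    simp only [Matrix.mul_assoc]
  · rw [Matrix.det_mul, h_detS, h_detP, mul_one]
end
end

section
/- Let V be the 15×15 matrix over ℤ[q] whose rows and columns are indexed by the 15 subsets S ⊆ {1,2,3,4} with |S| ≤ 3 (ordered: the empty set; the four singletons; the six 2-element subsets; the four 3-element subsets), and whose (S,T) entry is q^{|S Δ T|}. Then there exists a unimodular 15×15 matrix M over ℤ[q] such that M V M^t = diag(1, (1−q²)·I_4, (1−q²)²·I_6, (1−q²)³·I_4). In particular, the q-Varchenko matrix of the hyperplane arrangement of the regular tetrahedron has Smith normal form diag(1, (1−q²)I_4, (1−q²)²I_6, (1−q²)³I_4) over ℤ[q]. -/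
open Matrix

noncomputable section

/-- The `15` subsets `S ⊆ {1,2,3,4}` with `|S| ≤ 3` (here `{1,2,3,4}` is rendered as
`Fin 4 = {0,1,2,3}`), in the order of the paper: the empty set; the four singletons;
the six `2`-element subsets `12, 23, 34, 14, 13, 24`; the four `3`-element subsets
`123, 234, 341, 412`. -/
def tetSets : Fin 15 → Finset (Fin 4) :=
  ![∅, {0}, {1}, {2}, {3},
    {0, 1}, {1, 2}, {2, 3}, {0, 3}, {0, 2}, {1, 3},
    {0, 1, 2}, {1, 2, 3}, {2, 3, 0}, {3, 0, 1}]

/-- The `q`-Varchenko matrix of the regular tetrahedron arrangement: the `(S,T)`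
entry is `q^|S Δ T|`. -/
def Vtet : Matrix (Fin 15) (Fin 15) (Polynomial ℤ) :=
  Matrix.of fun i j => q ^ (symmDiff (tetSets i) (tetSets j)).card

/-- The diagonal matrix `diag(1, (1-q²)·I₄, (1-q²)²·I₆, (1-q²)³·I₄)`. -/
def Dtet : Matrix (Fin 15) (Fin 15) (Polynomial ℤ) :=
  Matrix.diagonal fun k =>
    if (k : ℕ) = 0 then 1
    else if (k : ℕ) ≤ 4 then 1 - q ^ 2
    else if (k : ℕ) ≤ 10 then (1 - q ^ 2) ^ 2
    else (1 - q ^ 2) ^ 3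

/-- Product kernel on subsets of `Fin 4` attached to a 2×2 table. -/
def ker (a : Bool → Bool → Polynomial ℤ) (S T : Finset (Fin 4)) : Polynomial ℤ :=
  ∏ i, a (decide (i ∈ S)) (decide (i ∈ T))

/-- The lower unitriangular 2×2 table. -/
def la : Bool → Bool → Polynomial ℤ
  | false, false => 1
  | false, true => 0
  | true, false => -q
  | true, true => 1

/-- The 2×2 Varchenko table. -/
def va : Bool → Bool → Polynomial ℤ
  | false, false => 1
  | false, true => q
  | true, false => q
  | true, true => 1

lemma ker_mul (a b : Bool → Bool → Polynomial ℤ) (S U : Finset (Fin 4)) :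
    ∑ T, ker a S T * ker b T U =
      ker (fun s u => a s true * b true u + a s false * b false u) S U := by
  unfold ker
  rw [Finset.prod_add, Finset.powerset_univ]
  refine Finset.sum_congr rfl fun T _ => ?_
  rw [← Finset.prod_mul_distrib,
    ← Finset.prod_sdiff (Finset.subset_univ T), mul_comm]
  congr 1
  · exact Finset.prod_congr rfl fun i hi => by simp [hi]
  · refine Finset.prod_congr rfl fun i hi => ?_
    have : i ∉ T := (Finset.mem_sdiff.mp hi).2
    simp [this]

lemma univ_eq : (Finset.univ : Finset (Finset (Fin 4))) =
    insert Finset.univ (Finset.univ.image tetSets) := by decide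

lemma tet_inj : Function.Injective tetSets := by
  unfold Function.Injective; decide

lemma tet_ne (i : Fin 15) : tetSets i ≠ Finset.univ := by
  revert i; decide

lemma sum_tet (f : Finset (Fin 4) → Polynomial ℤ) (h : f Finset.univ = 0) :
    ∑ k, f (tetSets k) = ∑ T, f T := by
  rw [univ_eq, Finset.sum_insert, h, zero_add, Finset.sum_image (fun _ _ _ _ e => tet_inj e)]
  simp [tet_ne]

lemma ker_la_univ (i : Fin 15) : ker la (tetSets i) Finset.univ = 0 := by
  have : ∃ x, x ∉ tetSets i := by revert i; decide
  obtain ⟨x, hx⟩ := this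
  exact Finset.prod_eq_zero (Finset.mem_univ x) (by simp [hx, la])

lemma ker_va (S T : Finset (Fin 4)) : ker va S T = q ^ (symmDiff S T).card := by
  have h : ∀ i ∈ Finset.univ, i ∉ symmDiff S T →
      va (decide (i ∈ S)) (decide (i ∈ T)) = 1 := by
    intro i _ hi
    rw [Finset.mem_symmDiff] at hi
    by_cases h1 : i ∈ S <;> by_cases h2 : i ∈ T <;> simp_all [va]
  unfold ker
  rw [← Finset.prod_const, ← Finset.prod_subset (Finset.subset_univ (symmDiff S T)) h]
  refine Finset.prod_congr rfl fun i hi => ?_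
  rw [Finset.mem_symmDiff] at hi
  by_cases h1 : i ∈ S <;> by_cases h2 : i ∈ T <;> simp_all [va]

/-- The unimodular transforming matrix. -/
def Mtet : Matrix (Fin 15) (Fin 15) (Polynomial ℤ) :=
  Matrix.of fun i j => ker la (tetSets i) (tetSets j)

lemma Mtet_det : Mtet.det = 1 := by
  rw [Matrix.det_of_lowerTriangular]
  · refine Finset.prod_eq_one fun i _ => ?_
    change ker la (tetSets i) (tetSets i) = 1
    unfold ker
    refine Finset.prod_eq_one fun x _ => ?_
    by_cases h : x ∈ tetSets i <;> simp [h, la]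
  · intro i j hij
    have key : ∀ i j : Fin 15, i < j → ∃ x, x ∉ tetSets i ∧ x ∈ tetSets j := by decide
    obtain ⟨x, h1, h2⟩ := key i j hij
    change ker la (tetSets i) (tetSets j) = 0
    unfold ker
    exact Finset.prod_eq_zero (Finset.mem_univ x) (by simp [h1, h2, la])

lemma ker_diag (a : Bool → Bool → Polynomial ℤ) (h0 : a false false = 1)
    (h1 : a true true = 1 - q ^ 2) (h2 : a false true = 0) (h3 : a true false = 0)
    (S T : Finset (Fin 4)) :
    ker a S T = if S = T then (1 - q ^ 2) ^ S.card else 0 := by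
  split_ifs with h
  · subst h
    unfold ker
    rw [← Finset.prod_const, ← Finset.prod_subset (Finset.subset_univ S)
      (f := fun i => a (decide (i ∈ S)) (decide (i ∈ S)))]
    · exact Finset.prod_congr rfl fun i hi => by simp [hi, h1]
    · intro i _ hi
      simp [hi, h0]
  · have : ∃ x, ¬ (x ∈ S ↔ x ∈ T) := by
      by_contra hc
      push Not at hc
      exact h (Finset.ext hc)
    obtain ⟨x, hx⟩ := this
    refine Finset.prod_eq_zero (Finset.mem_univ x) ?_
    by_cases u : x ∈ S <;> by_cases v : x ∈ T <;> simp_all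

lemma tet_card (i : Fin 15) : (tetSets i).card =
    if (i : ℕ) = 0 then 0 else if (i : ℕ) ≤ 4 then 1 else if (i : ℕ) ≤ 10 then 2 else 3 := by
  revert i; decide

lemma ker_swap (a : Bool → Bool → Polynomial ℤ) (S T : Finset (Fin 4)) :
    ker a S T = ker (fun s t => a t s) T S := rfl

lemma Mtet_mul : Mtet * Vtet * Mtetᵀ = Dtet := by
  have hMV : ∀ i k, (Mtet * Vtet) i k = ker (fun s u =>
      la s true * va true u + la s false * va false u) (tetSets i) (tetSets k) := by
    intro i k
    rw [← ker_mul, ← sum_tet _ (by rw [ker_la_univ, zero_mul]), Matrix.mul_apply]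
    refine Finset.sum_congr rfl fun j _ => ?_
    rw [ker_va]
    rfl
  ext1 i j
  have hT : ∀ k, Mtetᵀ k j = ker (fun s t => la t s) (tetSets k) (tetSets j) := fun k => rfl
  rw [Matrix.mul_apply]
  simp only [hMV, hT]
  rw [sum_tet (fun T => ker _ (tetSets i) T * ker _ T (tetSets j))
    (by rw [← ker_swap la, ker_la_univ, mul_zero]), ker_mul, ker_diag]
  · unfold Dtet
    rw [Matrix.diagonal_apply]
    simp only [tet_inj.eq_iff, tet_card]
    split_ifs <;> simp
  all_goals simp only [la, va]; ring

/-- **Section 4.1.**  The `q`-Varchenko matrix of the hyperplane arrangement of the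
regular tetrahedron has Smith normal form
`diag(1, (1-q²)I₄, (1-q²)²I₆, (1-q²)³I₄)` over `ℤ[q]`, realized by a unimodular
congruence `M V Mᵀ`. -/
theorem tetrahedron_snf :
    ∃ M : Matrix (Fin 15) (Fin 15) (Polynomial ℤ),
      (M.det = 1 ∨ M.det = -1) ∧ M * Vtet * Mᵀ = Dtet := by
  exact ⟨Mtet, Or.inl Mtet_det, Mtet_mul⟩
end
end

section
/- Let V be the 27×27 matrix over ℤ[q] whose rows and columns are indexed by the following 27 subsets of {1,2,3,4,5,6}: the empty set; the six singletons {1},…,{6}; the twelve pairs {1,2},{2,3},{3,4},{4,5},{5,6},{6,1},{1,3},{2,4},{3,5},{4,6},{1,5},{2,6}; and the eight triples {1,2,3},{2,3,4},{3,4,5},{4,5,6},{5,6,1},{6,1,2},{1,3,5},{2,4,6}; with (S,T) entry q^{|S Δ T|}. Then there exists a unimodular 27×27 matrix M over ℤ[q] such that M V M^t = diag(1, (1−q²)·I_6, (1−q²)²·I_{12}, (1−q²)³·I_8). In particular, the q-Varchenko matrix of the hyperplane arrangement of the cube has Smith normal form diag(1, (1−q²)I_6, (1−q²)²I_{12}, (1−q²)³I_8)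 over ℤ[q]. -/
open Matrix

noncomputable section

/-- The `27` subsets of `{1,…,6}` (rendered as `Fin 6 = {0,…,5}`) indexing the regions
of the cube arrangement, in the order of the paper: the empty set; the six singletons;
the twelve pairs `12, 23, 34, 45, 56, 61, 13, 24, 35, 46, 15, 26`; the eight triples
`123, 234, 345, 456, 561, 612, 135, 246`. -/
def cubeSets : Fin 27 → Finset (Fin 6) :=
  ![∅,
    {0}, {1}, {2}, {3}, {4}, {5},
    {0, 1}, {1, 2}, {2, 3}, {3, 4}, {4, 5}, {5, 0},
    {0, 2}, {1, 3}, {2, 4}, {3, 5}, {0, 4}, {1, 5},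
    {0, 1, 2}, {1, 2, 3}, {2, 3, 4}, {3, 4, 5}, {4, 5, 0}, {5, 0, 1},
    {0, 2, 4}, {1, 3, 5}]

/-- The `q`-Varchenko matrix of the cube arrangement: the `(S,T)` entry is
`q^|S Δ T|`. -/
def Vcube : Matrix (Fin 27) (Fin 27) (Polynomial ℤ) :=
  Matrix.of fun i j => q ^ (symmDiff (cubeSets i) (cubeSets j)).card

/-- The diagonal matrix `diag(1, (1-q²)·I₆, (1-q²)²·I₁₂, (1-q²)³·I₈)`. -/
def Dcube : Matrix (Fin 27) (Fin 27) (Polynomial ℤ) :=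
  Matrix.diagonal fun k =>
    if (k : ℕ) = 0 then 1
    else if (k : ℕ) ≤ 6 then 1 - q ^ 2
    else if (k : ℕ) ≤ 18 then (1 - q ^ 2) ^ 2
    else (1 - q ^ 2) ^ 3

/-- position of a region with respect to the parallel pair `{a, a+3}` -/
def cubePos (a b : Fin 6) (i : Fin 27) : Fin 3 :=
  if a ∈ cubeSets i then 1 else if b ∈ cubeSets i then 2 else 0

def cubeIdx (i : Fin 27) : Fin 3 × Fin 3 × Fin 3 :=
  (cubePos 0 3 i, cubePos 1 4 i, cubePos 2 5 i)

set_option maxRecDepth 100000 in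
theorem cubeIdx_inj : Function.Injective cubeIdx := by
  unfold Function.Injective
  decide +kernel

def cubeEquiv : Fin 27 ≃ Fin 3 × Fin 3 × Fin 3 :=
  Equiv.ofBijective cubeIdx
    ((Fintype.bijective_iff_injective_and_card _).2 ⟨cubeIdx_inj, by simp⟩)

/-- distance between regions of two parallel hyperplanes -/
def lineDist (i j : Fin 3) : ℕ := if i = j then 0 else if i = 0 ∨ j = 0 then 1 else 2

def lineRank (i : Fin 3) : ℕ := if i = 0 then 0 else 1

set_option maxRecDepth 100000 in
theorem card_eq : ∀ i j : Fin 27, (symmDiff (cubeSets i) (cubeSets j)).card =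
    lineDist (cubeIdx i).1 (cubeIdx j).1 + (lineDist (cubeIdx i).2.1 (cubeIdx j).2.1 +
      lineDist (cubeIdx i).2.2 (cubeIdx j).2.2) := by
  decide +kernel

set_option maxRecDepth 100000 in
theorem rank_eq : ∀ k : Fin 27,
    lineRank (cubeIdx k).1 + (lineRank (cubeIdx k).2.1 + lineRank (cubeIdx k).2.2) =
    if (k : ℕ) = 0 then 0 else if (k : ℕ) ≤ 6 then 1 else if (k : ℕ) ≤ 18 then 2 else 3 := by
  decide +kernel

def lineV : Matrix (Fin 3) (Fin 3) (Polynomial ℤ) := Matrix.of fun i j => q ^ lineDist i j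

def lineM : Matrix (Fin 3) (Fin 3) (Polynomial ℤ) := !![1, 0, 0; -q, 1, 0; -q, 0, 1]

def lineD : Matrix (Fin 3) (Fin 3) (Polynomial ℤ) :=
  Matrix.diagonal fun i => (1 - q ^ 2) ^ lineRank i

theorem lineM_det : lineM.det = 1 := by
  simp [lineM, Matrix.det_fin_three]

theorem lineV_eq : lineV = !![1, q, q; q, 1, q ^ 2; q, q ^ 2, 1] := by
  ext1 i j
  fin_cases i <;> fin_cases j <;> simp [lineV, lineDist]

theorem line_snf : lineM * lineV * lineMᵀ = lineD := by
  rw [lineV_eq]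
  ext1 i j
  fin_cases i <;> fin_cases j <;>
    simp [lineM, lineD, lineRank, Matrix.mul_apply, Fin.sum_univ_three] <;> try ring

theorem Vcube_eq : Vcube = (kroneckerMap (· * ·) lineV (kroneckerMap (· * ·) lineV lineV)).submatrix
    cubeEquiv cubeEquiv := by
  ext1 i j
  simp only [Vcube, lineV, cubeEquiv, Matrix.of_apply, Matrix.submatrix_apply,
    kroneckerMap_apply, Equiv.ofBijective_apply, card_eq, pow_add]

theorem Dcube_eq : Dcube = (kroneckerMap (· * ·) lineD (kroneckerMap (· * ·) lineD lineD)).submatrix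
    cubeEquiv cubeEquiv := by
  have h : kroneckerMap (· * ·) lineD (kroneckerMap (· * ·) lineD lineD) =
      Matrix.diagonal fun p : Fin 3 × Fin 3 × Fin 3 =>
        (1 - q ^ 2) ^ (lineRank p.1 + (lineRank p.2.1 + lineRank p.2.2)) := by
    simp only [lineD, pow_add]
    rw [Matrix.diagonal_kronecker_diagonal, Matrix.diagonal_kronecker_diagonal]
  rw [h, Matrix.submatrix_diagonal_equiv, Dcube]
  congr 1
  funext k
  simp only [Function.comp, cubeEquiv, Equiv.ofBijective_apply, rank_eq]
  split_ifs <;> simp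

theorem cube_snf :
    ∃ M : Matrix (Fin 27) (Fin 27) (Polynomial ℤ),
      (M.det = 1 ∨ M.det = -1) ∧ M * Vcube * Mᵀ = Dcube := by
  refine ⟨(kroneckerMap (· * ·) lineM (kroneckerMap (· * ·) lineM lineM)).submatrix
    cubeEquiv cubeEquiv, Or.inl ?_, ?_⟩
  · rw [Matrix.det_submatrix_equiv_self, Matrix.det_kronecker, Matrix.det_kronecker, lineM_det]
    simp
  · rw [Vcube_eq, Dcube_eq, Matrix.transpose_submatrix, Matrix.submatrix_mul_equiv,
      Matrix.submatrix_mul_equiv, ← kroneckerMap_transpose, ← kroneckerMap_transpose,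
      ← Matrix.mul_kronecker_mul, ← Matrix.mul_kronecker_mul, ← Matrix.mul_kronecker_mul,
      ← Matrix.mul_kronecker_mul, line_snf]
end
end

section
/- Let V be the 59×59 matrix over ℤ[q] whose rows and columns are indexed by the following 59 subsets of {1,…,8}: the empty set; the eight singletons; the twelve pairs {1,6},{1,2},{2,3},{3,4},{4,5},{5,6},{1,7},{2,8},{3,7},{4,8},{5,7},{6,8}; the twenty-four triples {1,6,7},{1,2,8},{2,3,7},{3,4,8},{4,5,7},{5,6,8},{1,5,7},{2,6,8},{1,3,7},{2,4,8},{3,5,7},{4,6,8},{5,6,7},{1,6,8},{1,2,7},{2,3,8},{3,4,7},{4,5,8},{1,5,6},{1,2,6},{1,2,3},{2,3,4},{3,4,5},{4,5,6}; and the fourteen 4-element sets {1,2,6,7},{1,2,3,8},{2,3,4,7},{3,4,5,8},{4,5,6,7},{1,5,6,8},{1,3,5,7},{2,4,6,8},{1,5,6,7},{1,2,6,8},{1,2,3,7},{2,3,4,8},{3,4,5,7},{4,5,6,8}; with (S,T) entry q^{|S Δ T|}. Then there exist unimodular 59×59 matrices M and N over ℤ[q] such that M V N = diag(1, (1−q²)·I_8,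 (1−q²)²·I_{24}, (1−q²)³·I_{20}, (1−q²)²(1−q^8)·I_6). In particular, the q-Varchenko matrix of the hyperplane arrangement of the octahedron has Smith normal form diag(1, (1−q²)I_8, (1−q²)²I_{24}, (1−q²)³I_{20}, (1−q²)²(1−q^8)I_6) over ℤ[q]. -/
open Matrix

noncomputable section

/-- The `59` subsets of `{1,…,8}` (rendered as `Fin 8 = {0,…,7}`) indexing the regions
of the octahedron arrangement, in the order of the paper: the empty set; the eight
singletons; the twelve pairs `16, 12, 23, 34, 45, 56, 17, 28, 37, 48, 57, 68`; the
twenty-four triples `167, 128, 237, 348, 457, 568, 157, 268, 137, 248, 357, 468,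
567, 168, 127, 238, 347, 458, 156, 126, 123, 234, 345, 456`; the fourteen
`4`-element sets `1267, 1238, 2347, 3458, 4567, 1568, 1357, 2468, 1567, 1268, 1237,
2348, 3457, 4568`. -/
def octSets : Fin 59 → Finset (Fin 8) :=
  ![∅,
    {0}, {1}, {2}, {3}, {4}, {5}, {6}, {7},
    {0, 5}, {0, 1}, {1, 2}, {2, 3}, {3, 4}, {4, 5},
    {0, 6}, {1, 7}, {2, 6}, {3, 7}, {4, 6}, {5, 7},
    {0, 5, 6}, {0, 1, 7}, {1, 2, 6}, {2, 3, 7}, {3, 4, 6}, {4, 5, 7},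
    {0, 4, 6}, {1, 5, 7}, {0, 2, 6}, {1, 3, 7}, {2, 4, 6}, {3, 5, 7},
    {4, 5, 6}, {0, 5, 7}, {0, 1, 6}, {1, 2, 7}, {2, 3, 6}, {3, 4, 7},
    {0, 4, 5}, {0, 1, 5}, {0, 1, 2}, {1, 2, 3}, {2, 3, 4}, {3, 4, 5},
    {0, 1, 5, 6}, {0, 1, 2, 7}, {1, 2, 3, 6}, {2, 3, 4, 7}, {3, 4, 5, 6},
    {0, 4, 5, 7}, {0, 2, 4, 6}, {1, 3, 5, 7}, {0, 4, 5, 6}, {0, 1, 5, 7},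
    {0, 1, 2, 6}, {1, 2, 3, 7}, {2, 3, 4, 6}, {3, 4, 5, 7}]

/-- The `q`-Varchenko matrix of the octahedron arrangement: the `(S,T)` entry is
`q^|S Δ T|`. -/
def Voct : Matrix (Fin 59) (Fin 59) (Polynomial ℤ) :=
  Matrix.of fun i j => q ^ (symmDiff (octSets i) (octSets j)).card

/-- The diagonal matrix
`diag(1, (1-q²)·I₈, (1-q²)²·I₂₄, (1-q²)³·I₂₀, (1-q²)²(1-q⁸)·I₆)`. -/
def Doct : Matrix (Fin 59) (Fin 59) (Polynomial ℤ) :=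
  Matrix.diagonal fun k =>
    if (k : ℕ) = 0 then 1
    else if (k : ℕ) ≤ 8 then 1 - q ^ 2
    else if (k : ℕ) ≤ 32 then (1 - q ^ 2) ^ 2
    else if (k : ℕ) ≤ 52 then (1 - q ^ 2) ^ 3
    else (1 - q ^ 2) ^ 2 * (1 - q ^ 8)

/-! ### A small verified calculator for matrices over `ℤ[q]`

Polynomials are coefficient lists (lowest degree first), matrices are lists of rows. -/

/-- The polynomial with the given list of coefficients. -/
def ev : List ℤ → Polynomial ℤ
  | [] => 0
  | a :: l => Polynomial.C a + Polynomial.X * ev l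

/-- Sum of coefficient lists. -/
def padd : List ℤ → List ℤ → List ℤ
  | [], m => m
  | a :: l, [] => a :: l
  | a :: l, b :: m => (a + b) :: padd l m

/-- Scalar multiple of a coefficient list. -/
def pscale (c : ℤ) : List ℤ → List ℤ
  | [] => []
  | a :: l => (c * a) :: pscale c l

/-- Product of coefficient lists. -/
def pmul : List ℤ → List ℤ → List ℤ
  | [], _ => []
  | _ :: _, [] => []
  | a :: l, b :: m => padd (pscale a (b :: m)) (0 :: pmul l (b :: m))

/-- All coefficients vanish. -/
def pzero : List ℤ → Bool
  | [] => true
  | a :: l => decide (a = 0) && pzero l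

/-- Equality of coefficient lists up to trailing zeros. -/
def peq : List ℤ → List ℤ → Bool
  | [], m => pzero m
  | a :: l, [] => decide (a = 0) && peq l []
  | a :: l, b :: m => decide (a = b) && peq l m

/-- The monomial `q ^ k`. -/
def pmono : ℕ → List ℤ
  | 0 => [1]
  | k + 1 => 0 :: pmono k

theorem ev_padd (l m : List ℤ) : ev (padd l m) = ev l + ev m := by
  induction l generalizing m with
  | nil => simp [padd, ev]
  | cons a l ih =>
    cases m with
    | nil => simp [padd, ev]
    | cons b m => simp only [padd, ev, ih, Polynomial.C_add]; ring

theorem ev_pscale (c : ℤ) (l : List ℤ) : ev (pscale c l) = Polynomial.C c * ev l := by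
  induction l with
  | nil => simp [pscale, ev]
  | cons a l ih => simp only [pscale, ev, ih, Polynomial.C_mul]; ring

theorem ev_pmul (l m : List ℤ) : ev (pmul l m) = ev l * ev m := by
  induction l with
  | nil => simp [pmul, ev]
  | cons a l ih =>
    cases m with
    | nil => simp [pmul, ev]
    | cons b m =>
      simp only [pmul, ev_padd, ev_pscale]
      rw [ev.eq_2 0, ih, ev.eq_2 a l]
      simp only [Polynomial.C_0]
      ring

theorem ev_pzero (l : List ℤ) (h : pzero l = true) : ev l = 0 := by
  induction l with
  | nil => rfl
  | cons a l ih =>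
    simp only [pzero, Bool.and_eq_true, decide_eq_true_eq] at h
    rw [ev, ih h.2, h.1]; simp

theorem ev_peq (l m : List ℤ) (h : peq l m = true) : ev l = ev m := by
  induction l generalizing m with
  | nil => exact (ev_pzero m h).symm
  | cons a l ih =>
    cases m with
    | nil =>
      simp only [peq, Bool.and_eq_true, decide_eq_true_eq] at h
      rw [ev.eq_2, ih _ h.2, h.1]; simp [ev]
    | cons b m =>
      simp only [peq, Bool.and_eq_true, decide_eq_true_eq] at h
      rw [ev.eq_2, ih _ h.2, h.1, ev.eq_2]

theorem ev_pmono (k : ℕ) : ev (pmono k) = q ^ k := by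
  induction k with
  | zero => simp [pmono, ev]
  | succ k ih => simp only [pmono, ev, ih, q, Polynomial.C_0]; ring

/-- Sum of rows. -/
def radd : List (List ℤ) → List (List ℤ) → List (List ℤ)
  | [], m => m
  | a :: l, [] => a :: l
  | a :: l, b :: m => padd a b :: radd l m

/-- Multiple of a row by a polynomial. -/
def rscale (c : List ℤ) : List (List ℤ) → List (List ℤ)
  | [] => []
  | a :: l => pmul c a :: rscale c l

/-- Linear combination of rows. -/
def comb_s13 : List (List ℤ) → List (List (List ℤ)) → List (List ℤ)
  | [], _ => []
  | _ :: _, [] => []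
  | [] :: cs, _ :: rs => comb_s13 cs rs
  | (a :: c) :: cs, r :: rs => radd (rscale (a :: c) r) (comb_s13 cs rs)

/-- Matrix product. -/
def mmul : List (List (List ℤ)) → List (List (List ℤ)) → List (List (List ℤ))
  | [], _ => []
  | r :: rs, B => comb_s13 r B :: mmul rs B

theorem ev_radd (l m : List (List ℤ)) (j : ℕ) :
    ev ((radd l m).getD j []) = ev (l.getD j []) + ev (m.getD j []) := by
  induction l generalizing m j with
  | nil => simp [radd, ev]
  | cons a l ih =>
    cases m with
    | nil => simp [radd, ev]
    | cons b m =>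
      cases j with
      | zero => simp [radd, ev_padd]
      | succ j => simpa [radd] using ih m j

theorem ev_rscale (c : List ℤ) (l : List (List ℤ)) (j : ℕ) :
    ev ((rscale c l).getD j []) = ev c * ev (l.getD j []) := by
  induction l generalizing j with
  | nil => simp [rscale, ev]
  | cons a l ih =>
    cases j with
    | zero => simp [rscale, ev_pmul]
    | succ j => simpa [rscale] using ih j

theorem ev_comb (cs : List (List ℤ)) (rs : List (List (List ℤ))) (j : ℕ) :
    ev ((comb_s13 cs rs).getD j []) =
      ∑ k ∈ Finset.range rs.length, ev (cs.getD k []) * ev ((rs.getD k []).getD j []) := by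
  induction cs generalizing rs with
  | nil => simp [comb_s13, ev]
  | cons c cs ih =>
    cases rs with
    | nil => cases c <;> simp [comb_s13, ev]
    | cons r rs =>
      rw [List.length_cons, Finset.sum_range_succ']
      simp only [List.getD_cons_succ, List.getD_cons_zero]
      rw [← ih rs]
      cases c with
      | nil => simp [comb_s13, ev]
      | cons a c => simp only [comb_s13, ev_radd, ev_rscale]; ring

theorem mmul_getD (A B : List (List (List ℤ))) (i : ℕ) :
    (mmul A B).getD i [] = comb_s13 (A.getD i []) B := by
  induction A generalizing i with
  | nil => simp [mmul, comb_s13]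
  | cons r A ih =>
    cases i with
    | zero => simp [mmul]
    | succ i => simpa [mmul] using ih i

/-- The `(i, j)` entry of a matrix given as a list of rows. -/
def entry (A : List (List (List ℤ))) (i j : ℕ) : List ℤ := (A.getD i []).getD j []

/-- The matrix over `ℤ[q]` with the given list of rows. -/
def toMat (A : List (List (List ℤ))) : Matrix (Fin 59) (Fin 59) (Polynomial ℤ) :=
  Matrix.of fun i j => ev (entry A i j)

theorem toMat_mmul (A B : List (List (List ℤ))) (hB : B.length = 59) :
    toMat (mmul A B) = toMat A * toMat B := by
  ext1 i j
  simp only [toMat, Matrix.mul_apply, Matrix.of_apply, entry, mmul_getD, ev_comb, hB]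
  rw [Finset.sum_range]

/-- Row equality up to trailing zeros. -/
def req : List (List ℤ) → List (List ℤ) → Bool
  | [], [] => true
  | a :: l, b :: m => peq a b && req l m
  | _, _ => false

/-- Matrix equality up to trailing zeros of the entries. -/
def meq : List (List (List ℤ)) → List (List (List ℤ)) → Bool
  | [], [] => true
  | a :: l, b :: m => req a b && meq l m
  | _, _ => false

theorem ev_req (l m : List (List ℤ)) (h : req l m = true) (j : ℕ) :
    ev (l.getD j []) = ev (m.getD j []) := by
  induction l generalizing m j with
  | nil => cases m with
    | nil => rfl
    | cons b m => simp [req] at h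
  | cons a l ih => cases m with
    | nil => simp [req] at h
    | cons b m =>
      simp only [req, Bool.and_eq_true] at h
      cases j with
      | zero => simpa using ev_peq _ _ h.1
      | succ j => simpa using ih m h.2 j

theorem ev_meq (l m : List (List (List ℤ))) (h : meq l m = true) (i j : ℕ) :
    ev (entry l i j) = ev (entry m i j) := by
  induction l generalizing m i with
  | nil => cases m with
    | nil => rfl
    | cons b m => simp [meq] at h
  | cons a l ih => cases m with
    | nil => simp [meq] at h
    | cons b m =>
      simp only [meq, Bool.and_eq_true] at h
      cases i with
      | zero => simpa [entry] using ev_req _ _ h.1 j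
      | succ i => simpa [entry] using ih m h.2 i

theorem toMat_meq (l m : List (List (List ℤ))) (h : meq l m = true) : toMat l = toMat m := by
  ext1 i j
  exact ev_meq l m h i j

/-! ### The data -/

/-- The regions as bit masks. -/
def masks : List ℕ :=
  [0, 1, 2, 4, 8, 16, 32, 64, 128, 33, 3, 6, 12, 24, 48, 65, 130, 68, 136, 80, 160, 97, 131,
   70, 140, 88, 176, 81, 162, 69, 138, 84, 168, 112, 161, 67, 134, 76, 152, 49, 35, 7, 14,
   28, 56, 99, 135, 78, 156, 120, 177, 85, 170, 113, 163, 71, 142, 92, 184]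

/-- Number of ones among the eight lowest binary digits. -/
def pop (n : ℕ) : ℕ :=
  n % 2 + n / 2 % 2 + n / 4 % 2 + n / 8 % 2 + n / 16 % 2 + n / 32 % 2 + n / 64 % 2 + n / 128 % 2

/-- Number of hyperplanes separating two regions. -/
def sep (i j : ℕ) : ℕ := pop (Nat.xor (masks.getD i 0) (masks.getD j 0))

/-- Tabulate a `59 × 59` matrix. -/
def tab (f : ℕ → ℕ → List ℤ) : List (List (List ℤ)) :=
  (List.range 59).map fun i => (List.range 59).map fun j => f i j

/-- The `q`-Varchenko matrix. -/
def Vl : List (List (List ℤ)) := tab fun i j => pmono (sep i j)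

/-- The support of the triangular factor: inclusions, with a correction near the six vertices
of the octahedron (where four planes meet). -/
def rel (i j : ℕ) : Bool :=
  (Nat.beq (Nat.land (masks.getD i 0) (masks.getD j 0)) (masks.getD j 0)
    && !(Nat.ble 53 i && Nat.ble 33 j && Nat.ble j 44))
  || (Nat.ble 33 i && Nat.ble i 44 && Nat.beq (j + 12) i)
  || (Nat.ble 45 i && Nat.ble i 50 &&
      (Nat.beq j (21 + (i - 43) % 6) || Nat.beq j (27 + (i - 44) % 6)))

/-- The lower unitriangular factor `L`, and its transpose. -/
def Ll : List (List (List ℤ)) := tab fun i j => bif rel i j then pmono (sep i j) else []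

/-- The transpose of `L`. -/
def Lt : List (List (List ℤ)) := tab fun i j => bif rel j i then pmono (sep i j) else []

/-- The regions `33 + k`, `39 + k`, `53 + k` (`k < 6`) form six triples; the matrix which is
the identity outside these triples and unitriangular on each of them, with the six off-diagonal
entries as given. -/
def blk (ab ad ba bd da db : List ℤ) : List (List (List ℤ)) := tab fun i j =>
  bif Nat.beq i j then [1]
  else bif Nat.ble 33 i && Nat.ble i 38 then
    bif Nat.beq j (i + 6) then ab else bif Nat.beq j (i + 20) then ad else []
  else bif Nat.ble 39 i && Nat.ble i 44 then
    bif Nat.beq (j + 6) i then ba else bif Nat.beq j (i + 14) then bd else []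
  else bif Nat.ble 53 i then
    bif Nat.beq (j + 20) i then da else bif Nat.beq (j + 14) i then db else []
  else []

/-- The almost diagonal matrix `B` with `V = L B Lᵀ`. -/
def Bl : List (List (List ℤ)) := tab fun i j =>
  bif Nat.beq i j then
    bif Nat.beq i 0 then [1] else bif Nat.ble i 8 then [1, 0, -1]
    else bif Nat.ble i 32 then [1, 0, -2, 0, 1]
    else bif Nat.ble 45 i && Nat.ble i 52 then [1, 0, -3, 0, 3, 0, -1]
    else [1, 0, -2, 0, 0, 0, 2, 0, -1]
  else bif (Nat.ble 53 i && (Nat.beq (j + 20) i || Nat.beq (j + 14) i))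
      || (Nat.ble 53 j && (Nat.beq (i + 20) j || Nat.beq (i + 14) j)) then
    [0, 1, 0, -3, 0, 3, 0, -1]
  else []

/-- The Smith normal form. -/
def Dl : List (List (List ℤ)) := tab fun i j =>
  bif Nat.beq i j then
    bif Nat.beq i 0 then [1] else bif Nat.ble i 8 then [1, 0, -1]
    else bif Nat.ble i 32 then [1, 0, -2, 0, 1]
    else bif Nat.ble i 52 then [1, 0, -3, 0, 3, 0, -1]
    else [1, 0, -2, 0, 1, 0, 0, 0, -1, 0, 2, 0, -1]
  else []

/-- First row operation. -/
def R1 : List (List (List ℤ)) := blk [] [] [0, 0, 1] [] [0, 0, 0, 1] []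
/-- Second row operation. -/
def R2 : List (List (List ℤ)) := blk [] [] [] [0, -1] [] []
/-- Third row operation. -/
def R3 : List (List (List ℤ)) := blk [] [] [] [] [] [0, -1]
/-- First column operation. -/
def C1 : List (List (List ℤ)) := blk [] [] [] [] [0, -1] []
/-- Second column operation. -/
def C2 : List (List (List ℤ)) := blk [] [0, -1] [] [0, 0, 0, 0, 0, 1] [] []

set_option maxRecDepth 100000

theorem check_V : meq (mmul (mmul Ll Bl) Lt) Vl = true := by decide +kernel

theorem check_D :
    meq (mmul (mmul R3 (mmul R2 (mmul R1 Bl))) (mmul C1 C2)) Dl = true := by decide +kernel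

theorem det_lower (A : List (List (List ℤ)))
    (h : ∀ i j : Fin 59, i ≤ j → entry A i j = if i = j then [1] else []) :
    (toMat A).det = 1 := by
  rw [Matrix.det_of_isLowerTriangular]
  · refine Finset.prod_eq_one fun i _ => ?_
    simp [toMat, h i i le_rfl, ev]
  · intro i j hij
    have hij' : i < j := hij
    simp [toMat, h i j hij'.le, hij'.ne, ev]

theorem det_upper (A : List (List (List ℤ)))
    (h : ∀ i j : Fin 59, j ≤ i → entry A i j = if i = j then [1] else []) :
    (toMat A).det = 1 := by
  rw [Matrix.det_of_isUpperTriangular]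
  · refine Finset.prod_eq_one fun i _ => ?_
    simp [toMat, h i i le_rfl, ev]
  · intro i j hij
    have hij' : j < i := hij
    simp [toMat, h i j hij'.le, hij'.ne', ev]

theorem det_Ll : (toMat Ll).det = 1 := det_lower _ (by decide +kernel)
theorem det_Lt : (toMat Lt).det = 1 := det_upper _ (by decide +kernel)
theorem det_R1 : (toMat R1).det = 1 := det_lower _ (by decide +kernel)
theorem det_R2 : (toMat R2).det = 1 := det_upper _ (by decide +kernel)
theorem det_R3 : (toMat R3).det = 1 := det_lower _ (by decide +kernel)
theorem det_C1 : (toMat C1).det = 1 := det_lower _ (by decide +kernel)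
theorem det_C2 : (toMat C2).det = 1 := det_upper _ (by decide +kernel)

theorem length_tab (f : ℕ → ℕ → List ℤ) : (tab f).length = 59 := by simp [tab]

theorem length_mmul (A B : List (List (List ℤ))) : (mmul A B).length = A.length := by
  induction A with
  | nil => rfl
  | cons r A ih => simp [mmul, ih]

theorem entry_Vl : ∀ i j : Fin 59,
    entry Vl i j = pmono (symmDiff (octSets i) (octSets j)).card := by decide +kernel

theorem toMat_Vl : toMat Vl = Voct := by
  ext1 i j
  simp only [toMat, Voct, Matrix.of_apply, entry_Vl, ev_pmono]

theorem entry_Dl : ∀ i j : Fin 59, entry Dl i j =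
    if i = j then
      if (i : ℕ) = 0 then [1] else if (i : ℕ) ≤ 8 then [1, 0, -1]
      else if (i : ℕ) ≤ 32 then [1, 0, -2, 0, 1]
      else if (i : ℕ) ≤ 52 then [1, 0, -3, 0, 3, 0, -1]
      else [1, 0, -2, 0, 1, 0, 0, 0, -1, 0, 2, 0, -1]
    else [] := by decide +kernel

theorem toMat_Dl : toMat Dl = Doct := by
  ext1 i j
  simp only [toMat, Doct, Matrix.of_apply, entry_Dl, Matrix.diagonal_apply]
  split_ifs <;> simp [ev, q] <;> ring

/-- **Section 4.3.**  The `q`-Varchenko matrix of the hyperplane arrangement of the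
octahedron has Smith normal form
`diag(1, (1-q²)I₈, (1-q²)²I₂₄, (1-q²)³I₂₀, (1-q²)²(1-q⁸)I₆)` over `ℤ[q]`,
realized by unimodular matrices `M, N` with `M V N` equal to this diagonal matrix. -/
theorem octahedron_snf :
    ∃ M N : Matrix (Fin 59) (Fin 59) (Polynomial ℤ),
      (M.det = 1 ∨ M.det = -1) ∧ (N.det = 1 ∨ N.det = -1) ∧ M * Voct * N = Doct := by
  have lB : Bl.length = 59 := length_tab _
  have lT : Lt.length = 59 := length_tab _
  have l2 : C2.length = 59 := length_tab _
  have l1 : (mmul C1 C2).length = 59 := (length_mmul _ _).trans (length_tab _)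
  have k1 : (mmul R1 Bl).length = 59 := (length_mmul _ _).trans (length_tab _)
  have k2 : (mmul R2 (mmul R1 Bl)).length = 59 := (length_mmul _ _).trans (length_tab _)
  have hV : toMat Ll * toMat Bl * toMat Lt = Voct := by
    rw [← toMat_Vl, ← toMat_meq _ _ check_V, toMat_mmul _ _ lT, toMat_mmul _ _ lB]
  have hD : toMat R3 * (toMat R2 * (toMat R1 * toMat Bl)) * (toMat C1 * toMat C2) = Doct := by
    rw [← toMat_Dl, ← toMat_meq _ _ check_D, toMat_mmul _ _ l1, toMat_mmul _ _ k2,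
      toMat_mmul _ _ k1, toMat_mmul _ _ lB, toMat_mmul _ _ l2]
  have hL : IsUnit (toMat Ll).det := by rw [det_Ll]; exact isUnit_one
  have hT : IsUnit (toMat Lt).det := by rw [det_Lt]; exact isUnit_one
  refine ⟨toMat R3 * (toMat R2 * toMat R1) * (toMat Ll)⁻¹,
    (toMat Lt)⁻¹ * (toMat C1 * toMat C2), Or.inl ?_, Or.inl ?_, ?_⟩
  · simp [Matrix.det_mul, Matrix.det_nonsing_inv, det_R1, det_R2, det_R3, det_Ll]
  · simp [Matrix.det_mul, Matrix.det_nonsing_inv, det_C1, det_C2, det_Lt]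
  · have h1 : (toMat Ll)⁻¹ * Voct * (toMat Lt)⁻¹ = toMat Bl := by
      rw [← hV, Matrix.mul_assoc (toMat Ll), Matrix.nonsing_inv_mul_cancel_left _ _ hL,
        Matrix.mul_nonsing_inv_cancel_right _ _ hT]
    rw [← hD, ← h1]
    simp only [Matrix.mul_assoc]
end
end
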